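/- arXiv:1012.5612 — 13 statements merged into one kernel-verified Lean document; each statement's English description precedes it below -/
import Mathlib

section
/- For every s ≠ 0 one has 0 < p·f(s) ≤ s·f'(s); that is, f satisfies the first condition of (f_μ) with μ₁ = p > 2. -/
open Real

theorem aux_deriv (r s : ℝ) (hs : s ≠ 0) :
    ∃ d : ℝ, HasDerivAt (fun x : ℝ => |x| ^ r) d s ∧ s * d = r * |s| ^ r := by
  have ha : 0 < |s| := abs_pos.mpr hs
  refine ⟨_, (hasDerivAt_abs hs).rpow_const (Or.inl ha.ne'), ?_⟩
  have h1 : |s| ^ r = |s| ^ (r - 1) * |s| := by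
    rw [Real.rpow_sub_one ha.ne']; field_simp
  have h2 : s * ((SignType.sign s : SignType) : ℝ) = |s| := self_mul_sign s
  rw [h1]
  linear_combination (r * |s| ^ (r - 1)) * h2

/-- First condition of (f_μ) with `μ₁ = p`: for `f s = |s|^q / (1 + |s|^(q-p))` with
`2 < p < q`, for every `s ≠ 0` one has `0 < p·f(s) ≤ s·f'(s)`. -/
theorem stmt2 (p q : ℝ) (hp : 2 < p) (hpq : p < q)
    (f : ℝ → ℝ) (hf : ∀ s : ℝ, f s = |s| ^ q / (1 + |s| ^ (q - p))) :
    ∀ s : ℝ, s ≠ 0 → 0 < p * f s ∧ p * f s ≤ s * deriv f s := by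
  intro s hs
  have ha : 0 < |s| := abs_pos.mpr hs
  obtain ⟨a, hA, ha'⟩ := aux_deriv q s hs
  obtain ⟨b, hB, hb'⟩ := aux_deriv (q - p) s hs
  have hA0 : 0 < |s| ^ q := Real.rpow_pos_of_pos ha q
  have hB0 : 0 < |s| ^ (q - p) := Real.rpow_pos_of_pos ha (q - p)
  have hD := hA.div (hB.const_add 1) (by positivity)
  have hfe : f = (fun x : ℝ => |x| ^ q) / (fun x : ℝ => 1 + |x| ^ (q - p)) := by
    funext x; simp [hf]
  rw [← hfe] at hD
  rw [hD.deriv, hf]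
  generalize |s| ^ q = A at *
  generalize |s| ^ (q - p) = B at *
  have hp0 : 0 < p := by linarith
  refine ⟨by positivity, ?_⟩
  have e : s * ((a * (1 + B) - A * b) / (1 + B) ^ 2) - p * (A / (1 + B))
      = A * (q - p) / (1 + B) ^ 2 := by
    field_simp
    linear_combination (1 + B) * ha' - A * hb'
  have : 0 ≤ A * (q - p) / (1 + B) ^ 2 := by
    have : 0 < q - p := by linarith
    positivity
  linarith
end

section
/- Let ε > 0 be a real number satisfying ε < q − 2, ε ≤ 2q − p − 2 and ε ≤ 2p − q − 2. Then for every s ≠ 0, (1 + ε)·s·f'(s) < s²·f''(s); that is, f satisfies the second condition of (f_μ) with μ₂ = 1 + ε > 1. -/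
open Real

lemma absrpow_deriv (a x : ℝ) (hx : x ≠ 0) :
    HasDerivAt (fun y : ℝ => |y| ^ a) (a * |x| ^ a / x) x := by
  have key : ∀ y : ℝ, y ≠ 0 → |y| ^ a = Real.exp (Real.log y * a) := by
    intro y hy
    rw [Real.rpow_def_of_pos (abs_pos.mpr hy), Real.log_abs]
  have h1 : HasDerivAt (fun y : ℝ => Real.exp (Real.log y * a))
      (Real.exp (Real.log x * a) * (x⁻¹ * a)) x :=
    ((Real.hasDerivAt_log hx).mul_const a).exp
  have h2 := h1.congr_of_eventuallyEq (f₁ := fun y : ℝ => |y| ^ a)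
    (by filter_upwards [isOpen_ne.mem_nhds hx] with y hy using key y hy)
  have h3 : a * |x| ^ a / x = Real.exp (Real.log x * a) * (x⁻¹ * a) := by
    rw [key x hx]
    ring
  rw [h3]
  exact h2

/-- Second condition of (f_μ) with `μ₂ = 1 + ε`: for `f s = |s|^q / (1 + |s|^(q-p))` with
`2 < p < q` and `ε > 0` satisfying `ε < q - 2`, `ε ≤ 2q - p - 2`, `ε ≤ 2p - q - 2`,
for every `s ≠ 0` one has `(1 + ε)·s·f'(s) < s²·f''(s)`. -/
theorem stmt3 (p q : ℝ) (hp : 2 < p) (hpq : p < q)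
    (f : ℝ → ℝ) (hf : ∀ s : ℝ, f s = |s| ^ q / (1 + |s| ^ (q - p)))
    (ε : ℝ) (hε : 0 < ε) (hε1 : ε < q - 2) (hε2 : ε ≤ 2 * q - p - 2)
    (hε3 : ε ≤ 2 * p - q - 2) :
    ∀ s : ℝ, s ≠ 0 → (1 + ε) * (s * deriv f s) < s ^ 2 * deriv (deriv f) s := by
  intro s hs
  have hfe : f = fun s : ℝ => |s| ^ q / (1 + |s| ^ (q - p)) := funext hf
  have hpos : ∀ x : ℝ, 0 ≤ |x| ^ (q - p) := fun x => Real.rpow_nonneg (abs_nonneg x) _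
  have hd : ∀ x : ℝ, x ≠ 0 → deriv f x =
      |x| ^ q * (q + p * |x| ^ (q - p)) / ((1 + |x| ^ (q - p)) ^ 2 * x) := by
    intro x hx
    have hne : 1 + |x| ^ (q - p) ≠ 0 := by linarith [hpos x]
    have h := (absrpow_deriv q x hx).fun_div ((absrpow_deriv (q - p) x hx).const_add 1) hne
    rw [hfe, h.deriv]
    field_simp
    ring
  have hne : 1 + |s| ^ (q - p) ≠ 0 := by linarith [hpos s]
  have hdd : deriv (deriv f) s = deriv (fun x : ℝ =>
      |x| ^ q * (q + p * |x| ^ (q - p)) / ((1 + |x| ^ (q - p)) ^ 2 * x)) s := by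
    apply Filter.EventuallyEq.deriv_eq
    filter_upwards [isOpen_ne.mem_nhds hs] with y hy using hd y hy
  have A := absrpow_deriv q s hs
  have B := absrpow_deriv (q - p) s hs
  have h := (A.fun_mul ((B.const_mul p).const_add q)).fun_div
    (((B.const_add 1).fun_pow 2).fun_mul (hasDerivAt_id' s))
    (mul_ne_zero (pow_ne_zero 2 hne) hs)
  rw [hdd, h.deriv, hd s hs]
  have ha : 0 < |s| ^ q := Real.rpow_pos_of_pos (abs_pos.mpr hs) _
  have ht : 0 < |s| ^ (q - p) := Real.rpow_pos_of_pos (abs_pos.mpr hs) _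
  generalize |s| ^ q = a at *
  generalize |s| ^ (q - p) = t at *
  have hK : 0 < q * (q - 2 - ε) + (q * (2 * p - q - 2 - ε) + p * (2 * q - p - 2 - ε)) * t
      + p * (p - 2 - ε) * t ^ 2 := by
    have h0 : 0 < q * (q - 2 - ε) := mul_pos (by linarith) (by linarith)
    have h1 : 0 ≤ q * (2 * p - q - 2 - ε) := mul_nonneg (by linarith) (by linarith)
    have h2 : 0 ≤ p * (2 * q - p - 2 - ε) := mul_nonneg (by linarith) (by linarith)
    have h3 : 0 ≤ p * (p - 2 - ε) := mul_nonneg (by linarith) (by linarith)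
    positivity
  have hP : 0 < a / (1 + t) ^ 3 * (q * (q - 2 - ε)
      + (q * (2 * p - q - 2 - ε) + p * (2 * q - p - 2 - ε)) * t
      + p * (p - 2 - ε) * t ^ 2) := by
    apply mul_pos (by positivity) hK
  rw [← sub_pos]
  convert hP using 1
  field_simp
  ring
end

section
/- For every real number p > 2 there exists δ > 0 such that for every real q with p < q < p + δ and every s ≠ 0, one has s³·f'''(s) > 0, where f(s) = |s|^q / (1 + |s|^{q−p}). -/
open Real

lemma aux_even (f : ℝ → ℝ) (c : ℝ) (h : ∀ x, f (-x) = c * f x) (x : ℝ) :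
    deriv f (-x) = (-c) * deriv f x := by
  have h1 := deriv_comp_neg f x
  have h2 : (fun x => f (-x)) = fun x => c * f x := funext h
  rw [h2, deriv_const_mul_field] at h1
  linarith

noncomputable def auxg (d t : ℝ) : ℝ := t ^ d / (1 + t ^ d)

lemma auxg_deriv (d t : ℝ) (ht : 0 < t) :
    HasDerivAt (auxg d) (d * auxg d t * (1 - auxg d t) / t) t := by
  have h1 : HasDerivAt (fun x : ℝ => x ^ d) (d * t ^ (d - 1)) t :=
    Real.hasDerivAt_rpow_const (Or.inl ht.ne')
  have hw : 0 < t ^ d := Real.rpow_pos_of_pos ht d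
  have h2 := h1.div (h1.const_add 1) (by positivity)
  refine h2.congr_deriv ?_
  rw [Real.rpow_sub_one ht.ne']
  unfold auxg
  generalize t ^ d = w at *
  field_simp

lemma aux_step (a d t : ℝ) (ht : 0 < t) (H : ℝ → ℝ) (H' : ℝ)
    (hH : HasDerivAt H H' (auxg d t)) :
    HasDerivAt (fun x => x ^ a * H (auxg d x))
      (t ^ (a - 1) * (a * H (auxg d t) + d * auxg d t * (1 - auxg d t) * H')) t := by
  have h1 : HasDerivAt (fun x : ℝ => x ^ a) (a * t ^ (a - 1)) t :=
    Real.hasDerivAt_rpow_const (Or.inl ht.ne')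
  have h2 := h1.mul (hH.comp t (auxg_deriv d t ht))
  refine h2.congr_deriv ?_
  rw [Real.rpow_sub_one ht.ne']
  simp only [Function.comp]
  field_simp

lemma aux_deriv_s4 (F : ℝ → ℝ) (a d : ℝ) (H H' : ℝ → ℝ)
    (hF : ∀ t, 0 < t → F t = t ^ a * H (auxg d t))
    (hH : ∀ x, HasDerivAt H (H' x) x) (t : ℝ) (ht : 0 < t) :
    deriv F t = t ^ (a - 1) * (a * H (auxg d t) + d * auxg d t * (1 - auxg d t) * H' (auxg d t)) := by
  have h := aux_step a d t ht H _ (hH _)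
  have he : F =ᶠ[nhds t] fun x => x ^ a * H (auxg d x) := by
    filter_upwards [lt_mem_nhds ht] with x hx using hF x hx
  rw [he.deriv_eq, h.deriv]

lemma aux_main (p q s : ℝ) (hs : 0 < s) :
    deriv (deriv (deriv (fun t : ℝ => |t| ^ q / (1 + |t| ^ (q - p))))) s =
      s ^ (p - 1 - 1 - 1) * (auxg (q - p) s * (p * (p - 1) * (p - 2)
        + (3 * p ^ 2 - 6 * p + 2) * (q - p) * (1 - auxg (q - p) s)
        + (3 * p - 3) * (q - p) ^ 2 * ((1 - auxg (q - p) s) * (1 - 2 * auxg (q - p) s))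
        + (q - p) ^ 3 * ((1 - auxg (q - p) s) *
          (1 - 6 * auxg (q - p) s + 6 * auxg (q - p) s ^ 2)))) := by
  set d := q - p with hd
  have k1 := aux_deriv_s4 (fun t : ℝ => |t| ^ q / (1 + |t| ^ d)) p d (fun x => x) (fun _ => 1)
    (by
      intro t ht
      have : q = p + d := by rw [hd]; ring
      simp only [abs_of_pos ht, auxg]
      rw [this, Real.rpow_add ht, mul_div_assoc]) (fun x => hasDerivAt_id x)
  have k2 := aux_deriv_s4 _ (p - 1) d (fun x => p * x + d * x * (1 - x) * 1)
    (fun x => p + d * (1 - 2 * x)) k1 (by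
      intro x
      have h := ((hasDerivAt_id x).const_mul p).add
        ((((hasDerivAt_id x).const_mul d).mul ((hasDerivAt_id x).const_sub 1)).mul_const 1)
      refine h.congr_deriv ?_
      simp only [id, Pi.mul_apply]
      ring)
  have k3 := aux_deriv_s4 _ (p - 1 - 1) d
    (fun x => (p - 1) * (p * x + d * x * (1 - x) * 1) + d * x * (1 - x) * (p + d * (1 - 2 * x)))
    (fun x => (p - 1) * (p + d * (1 - 2 * x)) + (d * (1 - 2 * x) * (p + d * (1 - 2 * x))
      + d * x * (1 - x) * (-2 * d))) k2 (by
      intro x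
      have h := (((hasDerivAt_id x).const_mul p).add
        ((((hasDerivAt_id x).const_mul d).mul ((hasDerivAt_id x).const_sub 1)).mul_const 1)).const_mul
          (p - 1)
      have h' := (((hasDerivAt_id x).const_mul d).mul ((hasDerivAt_id x).const_sub 1)).mul
        (((((hasDerivAt_id x).const_mul 2).const_sub 1).const_mul d).const_add p)
      refine (h.add h').congr_deriv ?_
      simp only [id, Pi.mul_apply]
      ring)
  rw [k3 s hs]
  ring

lemma aux_pos (p q s : ℝ) (hp : 2 < p) (hq : p < q) (h1 : q - p < 1)
    (h2 : (q - p) * (3 * p - 2) < p * (p - 1) * (p - 2)) (hs : 0 < s) :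
    0 < deriv (deriv (deriv (fun t : ℝ => |t| ^ q / (1 + |t| ^ (q - p))))) s := by
  rw [aux_main p q s hs]
  have hw : 0 < s ^ (q - p) := Real.rpow_pos_of_pos hs _
  have g0 : 0 < auxg (q - p) s := by unfold auxg; positivity
  have g1 : auxg (q - p) s < 1 := by
    unfold auxg; rw [div_lt_one (by positivity)]; linarith
  have hd : 0 < q - p := by linarith
  generalize q - p = d at *
  generalize auxg d s = g at *
  refine mul_pos (Real.rpow_pos_of_pos hs _) (mul_pos g0 ?_)
  have e1 : 0 ≤ (3 * p ^ 2 - 6 * p + 2) * d * (1 - g) := by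
    have : 0 < 3 * p ^ 2 - 6 * p + 2 := by nlinarith
    have : 0 < 1 - g := by linarith
    positivity
  have e2 : -1 ≤ (1 - g) * (1 - 2 * g) := by nlinarith [sq_nonneg (4 * g - 3)]
  have e3 : -1 ≤ (1 - g) * (1 - 6 * g + 6 * g ^ 2) := by
    have : -1 ≤ 1 - 6 * g + 6 * g ^ 2 := by nlinarith [sq_nonneg (2 * g - 1)]
    nlinarith
  have d2 : d ^ 2 ≤ d := by nlinarith
  have d3 : d ^ 3 ≤ d := by nlinarith
  have f2 : (3 * p - 3) * d ^ 2 * (-1) ≤ (3 * p - 3) * d ^ 2 * ((1 - g) * (1 - 2 * g)) :=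
    mul_le_mul_of_nonneg_left e2 (mul_nonneg (by linarith) (by positivity))
  have f3 : d ^ 3 * (-1) ≤ d ^ 3 * ((1 - g) * (1 - 6 * g + 6 * g ^ 2)) :=
    mul_le_mul_of_nonneg_left e3 (by positivity)
  have f4 : (3 * p - 3) * d ^ 2 ≤ (3 * p - 3) * d :=
    mul_le_mul_of_nonneg_left d2 (by linarith)
  linarith

/-- For every `p > 2` there exists `δ > 0` such that for every `q` with `p < q < p + δ`
and every `s ≠ 0`, one has `s³·f'''(s) > 0`, where `f s = |s|^q / (1 + |s|^(q-p))`. -/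
theorem stmt4 (p : ℝ) (hp : 2 < p) :
    ∃ δ : ℝ, 0 < δ ∧ ∀ q : ℝ, p < q → q < p + δ →
      ∀ s : ℝ, s ≠ 0 →
        0 < s ^ 3 *
          deriv (deriv (deriv (fun t : ℝ => |t| ^ q / (1 + |t| ^ (q - p))))) s := by
  have hA : 0 < p * (p - 1) * (p - 2) :=
    mul_pos (mul_pos (by linarith) (by linarith)) (by linarith)
  have hC : 0 < 3 * p - 2 := by linarith
  refine ⟨min 1 (p * (p - 1) * (p - 2) / (3 * p - 2)), lt_min one_pos (div_pos hA hC), ?_⟩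
  intro q hq hq2 s hs
  have h1 : q - p < 1 := by
    have := min_le_left 1 (p * (p - 1) * (p - 2) / (3 * p - 2)); linarith
  have h2 : (q - p) * (3 * p - 2) < p * (p - 1) * (p - 2) := by
    have := min_le_right 1 (p * (p - 1) * (p - 2) / (3 * p - 2))
    rw [← lt_div_iff₀ hC]; linarith
  rcases lt_or_gt_of_ne hs with hneg | hpos
  · have hp' := aux_pos p q (-s) hp hq h1 h2 (by linarith)
    have k := aux_even _ _ (aux_even _ _ (aux_even (fun t : ℝ => |t| ^ q / (1 + |t| ^ (q - p))) 1
      (by intro x; simp only [abs_neg, one_mul]))) s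
    rw [k] at hp'
    have : 0 < (-s) ^ 3 := pow_pos (by linarith) 3
    nlinarith [mul_pos this hp']
  · exact mul_pos (pow_pos hpos 3) (aux_pos p q s hp hq h1 h2 hpos)
end

section
/- One has lim_{s→0⁺} f'''(s)/s^{q−3} = q(q−1)(q−2) and lim_{s→+∞} f'''(s)/s^{p−3} = p(p−1)(p−2). -/
open Real Filter

lemma aux_deriv_s5 (f g g' : ℝ → ℝ) (h : ∀ s, 0 < s → f s = g s)
    (hg : ∀ s, 0 < s → HasDerivAt g (g' s) s) : ∀ s, 0 < s → deriv f s = g' s := by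
  intro s hs
  have : f =ᶠ[nhds s] g := by
    filter_upwards [Ioi_mem_nhds hs] with x hx using h x hx
  rw [this.deriv_eq, (hg s hs).deriv]

noncomputable def auxD (r a : ℝ) (Q : Polynomial ℝ) : Polynomial ℝ :=
  Polynomial.C a * Q - Polynomial.C r * (1 - Polynomial.X) *
    (Q + Polynomial.X * Polynomial.derivative Q)

noncomputable def auxV (r s : ℝ) : ℝ := (1 + s ^ r)⁻¹

lemma auxV_deriv (r s : ℝ) (hs : 0 < s) :
    HasDerivAt (auxV r) (-r * (auxV r s * (1 - auxV r s)) / s) s := by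
  have hpos : 0 < s ^ r := rpow_pos_of_pos hs r
  have h := ((Real.hasDerivAt_rpow_const (x := s) (p := r) (Or.inl hs.ne')).const_add 1).inv
    (by positivity)
  refine h.congr_deriv ?_
  unfold auxV
  rw [rpow_sub_one hs.ne']
  field_simp
  ring

lemma aux_step_s5 (r a : ℝ) (Q : Polynomial ℝ) (s : ℝ) (hs : 0 < s) :
    HasDerivAt (fun s => s ^ a * (auxV r s * Q.eval (auxV r s)))
      (s ^ (a - 1) * (auxV r s * (auxD r a Q).eval (auxV r s))) s := by
  have hV := auxV_deriv r s hs
  have hQ : HasDerivAt (fun s => Q.eval (auxV r s)) _ s :=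
    (Q.hasDerivAt (auxV r s)).comp s hV
  have h := (Real.hasDerivAt_rpow_const (x := s) (p := a) (Or.inl hs.ne')).mul (hV.mul hQ)
  refine h.congr_deriv ?_
  rw [rpow_sub_one hs.ne']
  simp only [auxD, Polynomial.eval_sub, Polynomial.eval_mul, Polynomial.eval_add,
    Polynomial.eval_C, Polynomial.eval_X, Polynomial.eval_one, Pi.mul_apply]
  field_simp
  ring

/-- For `f s = |s|^q / (1 + |s|^(q-p))` with `2 < p < q`, one has
`lim_{s→0⁺} f'''(s)/s^(q-3) = q(q-1)(q-2)` and
`lim_{s→+∞} f'''(s)/s^(p-3) = p(p-1)(p-2)`. -/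
theorem stmt5 (p q : ℝ) (hp : 2 < p) (hpq : p < q)
    (f : ℝ → ℝ) (hf : ∀ s : ℝ, f s = |s| ^ q / (1 + |s| ^ (q - p))) :
    Tendsto (fun s : ℝ => deriv (deriv (deriv f)) s / s ^ (q - 3))
      (nhdsWithin 0 (Set.Ioi 0)) (nhds (q * (q - 1) * (q - 2))) ∧
    Tendsto (fun s : ℝ => deriv (deriv (deriv f)) s / s ^ (p - 3))
      atTop (nhds (p * (p - 1) * (p - 2))) := by
  obtain ⟨r, hr⟩ : ∃ r, r = q - p := ⟨_, rfl⟩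
  have hr0 : 0 < r := by linarith
  have h0 : ∀ s, 0 < s → f s = s ^ q * (auxV r s * (1 : Polynomial ℝ).eval (auxV r s)) := by
    intro s hs
    rw [hf, abs_of_pos hs, ← hr]
    simp [auxV, div_eq_mul_inv]
  have h1 := aux_deriv_s5 _ _ _ h0 (aux_step_s5 r q 1)
  have h2 := aux_deriv_s5 _ _ _ h1 (aux_step_s5 r (q - 1) _)
  have h3 := aux_deriv_s5 _ _ _ h2 (aux_step_s5 r (q - 1 - 1) _)
  set Q := auxD r (q - 1 - 1) (auxD r (q - 1) (auxD r q 1)) with hQ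
  have hQ1 : Q.eval 1 = q * (q - 1) * (q - 2) := by
    simp [hQ, auxD]; ring
  have hQ0 : Q.eval 0 = p * (p - 1) * (p - 2) := by
    have : p = q - r := by linarith
    simp [hQ, auxD, this]; ring
  constructor
  · have hs : Tendsto (fun s : ℝ => s ^ r) (nhdsWithin 0 (Set.Ioi 0)) (nhds 0) := by
      have := (Real.continuousAt_rpow_const 0 r (Or.inr hr0.le)).tendsto
      rw [zero_rpow hr0.ne'] at this
      exact this.mono_left nhdsWithin_le_nhds
    have hV : Tendsto (auxV r) (nhdsWithin 0 (Set.Ioi 0)) (nhds 1) := by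
      have := (hs.const_add 1).inv₀ (by norm_num)
      simp only [add_zero, inv_one] at this
      exact this
    have hL := hV.mul ((Q.continuous.tendsto 1).comp hV)
    rw [hQ1, one_mul] at hL
    refine hL.congr' ?_
    filter_upwards [self_mem_nhdsWithin] with s hs
    have hs : 0 < s := hs
    rw [h3 s hs, show q - 1 - 1 - 1 = q - 3 by ring]
    have := rpow_pos_of_pos hs (q - 3)
    simp only [Function.comp]
    field_simp
  · have hs : Tendsto (fun s : ℝ => s ^ r) atTop atTop := tendsto_rpow_atTop hr0
    have hV : Tendsto (auxV r) atTop (nhds 0) :=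
      (tendsto_atTop_add_const_left _ 1 hs).inv_tendsto_atTop
    have hL := (hV.const_sub 1).mul ((Q.continuous.tendsto 0).comp hV)
    rw [hQ0, sub_zero, one_mul] at hL
    refine hL.congr' ?_
    filter_upwards [eventually_gt_atTop 0] with s hs
    rw [h3 s hs, show q - 1 - 1 - 1 = (p - 3) + r by rw [hr]; ring, rpow_add hs]
    have := rpow_pos_of_pos hs (p - 3)
    have h5 := rpow_pos_of_pos hs r
    have h4 : 1 - auxV r s = s ^ r * auxV r s := by
      unfold auxV
      field_simp
      ring
    simp only [Function.comp]
    rw [h4]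
    field_simp
end

section
/- For every real number A > 0 there exists a unique T > 0 such that ∫_{ℝ^N} f''(T·u(x))·u(x)² dx = A. (With A = ‖u‖_V², this says the ray {t·u : t > 0} meets the set 𝒱 = {w ≠ 0 : ‖w‖_V² = ∫ f''(w)w² dx} in exactly one point.) -/
open Real MeasureTheory

lemma aux_kle (p q T s : ℝ) (hT : 0 < T) (C : ℝ) (h1 : T ^ p ≤ C) (h2 : T ^ q ≤ C) :
    min (|T * s| ^ p) (|T * s| ^ q) ≤ C * min (|s| ^ p) (|s| ^ q) := by
  have hC : 0 ≤ C := (rpow_nonneg hT.le p).trans h1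
  rw [abs_mul, abs_of_pos hT, mul_rpow hT.le (abs_nonneg s), mul_rpow hT.le (abs_nonneg s),
    mul_min_of_nonneg _ _ hC]
  gcongr

lemma aux_kge (p q T s : ℝ) (hT : 0 < T) (C : ℝ) (hC : 0 ≤ C) (h1 : C ≤ T ^ p) (h2 : C ≤ T ^ q) :
    C * min (|s| ^ p) (|s| ^ q) ≤ min (|T * s| ^ p) (|T * s| ^ q) := by
  rw [abs_mul, abs_of_pos hT, mul_rpow hT.le (abs_nonneg s), mul_rpow hT.le (abs_nonneg s),
    mul_min_of_nonneg _ _ hC]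
  gcongr

lemma aux_main_s8 {X : Type*} [MeasurableSpace X] (μ : Measure X) (g : ℝ → ℝ) (hg : Measurable g)
    (p q c C : ℝ) (hp : 2 < p) (hpq : p < q) (hc : 0 < c) (hC : 0 < C)
    (hup : ∀ s, g s * s ^ 2 ≤ c * min (|s| ^ p) (|s| ^ q))
    (hlow : ∀ s, C * min (|s| ^ p) (|s| ^ q) ≤ g s * s ^ 2)
    (hcont : ∀ s, s ≠ 0 → ContinuousAt g s)
    (hm1 : StrictMonoOn g (Set.Ioi 0)) (hm2 : StrictAntiOn g (Set.Iio 0))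
    (u : X → ℝ) (hu : Measurable u) (hpos : 0 < μ {x | u x ≠ 0})
    (hint : Integrable (fun x => min (|u x| ^ p) (|u x| ^ q)) μ) (A : ℝ) (hA : 0 < A) :
    ∃! T : ℝ, 0 < T ∧ ∫ x, g (T * u x) * (u x) ^ 2 ∂μ = A := by
  set m : X → ℝ := fun x => min (|u x| ^ p) (|u x| ^ q) with hm
  have hm0 : ∀ x, 0 ≤ m x := fun x => by simp only [hm]; positivity
  have hKpos : 0 < ∫ x, m x ∂μ := by
    rw [integral_pos_iff_support_of_nonneg hm0 hint]
    refine hpos.trans_le (measure_mono ?_)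
    intro x hx
    have : 0 < |u x| := abs_pos.2 hx
    have : 0 < m x := by simp only [hm]; positivity
    exact this.ne'
  set K := ∫ x, m x ∂μ with hK
  have hmeas : ∀ T : ℝ, Measurable (fun x => g (T * u x) * (u x) ^ 2) := fun T => by
    fun_prop
  have hnn : ∀ T : ℝ, 0 < T → ∀ x, 0 ≤ g (T * u x) * (u x) ^ 2 := by
    intro T hT x
    have h1 := hlow (T * u x)
    have h2 : 0 ≤ C * min (|T * u x| ^ p) (|T * u x| ^ q) := by positivity
    have h3 : 0 ≤ T ^ 2 * (g (T * u x) * (u x) ^ 2) := by nlinarith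
    exact nonneg_of_mul_nonneg_right h3 (by positivity)
  have hle : ∀ T D : ℝ, 0 < T → T ^ p ≤ D → T ^ q ≤ D → ∀ x,
      g (T * u x) * (u x) ^ 2 ≤ (c * D / T ^ 2) * m x := by
    intro T D hT h1 h2 x
    have h3 := hup (T * u x)
    have h4 := mul_le_mul_of_nonneg_left (aux_kle p q T (u x) hT D h1 h2) hc.le
    rw [div_mul_eq_mul_div, le_div_iff₀ (by positivity)]
    simp only [hm]
    nlinarith
  have hge : ∀ T D : ℝ, 0 < T → 0 ≤ D → D ≤ T ^ p → D ≤ T ^ q → ∀ x,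
      (C * D / T ^ 2) * m x ≤ g (T * u x) * (u x) ^ 2 := by
    intro T D hT hD h1 h2 x
    have h3 := hlow (T * u x)
    have h4 := mul_le_mul_of_nonneg_left (aux_kge p q T (u x) hT D hD h1 h2) hC.le
    rw [div_mul_eq_mul_div, div_le_iff₀ (by positivity)]
    simp only [hm]
    nlinarith
  have hI : ∀ T : ℝ, 0 < T → Integrable (fun x => g (T * u x) * (u x) ^ 2) μ := by
    intro T hT
    refine (hint.const_mul (c * max (T ^ p) (T ^ q) / T ^ 2)).mono' (hmeas T).aestronglyMeasurable ?_
    refine Filter.Eventually.of_forall fun x => ?_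
    rw [Real.norm_eq_abs, abs_of_nonneg (hnn T hT x)]
    exact hle T _ hT (le_max_left _ _) (le_max_right _ _) x
  have hlt : ∀ S T x, 0 < S → S < T → u x ≠ 0 →
      g (S * u x) * (u x) ^ 2 < g (T * u x) * (u x) ^ 2 := by
    intro S T x hS hST hx
    have h2 : 0 < (u x) ^ 2 := by positivity
    refine mul_lt_mul_of_pos_right ?_ h2
    rcases lt_or_gt_of_ne hx with h | h
    · exact hm2 (mul_neg_of_pos_of_neg (hS.trans hST) h) (mul_neg_of_pos_of_neg hS h)
        (mul_lt_mul_of_neg_right hST h)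
    · exact hm1 (mul_pos hS h) (mul_pos (hS.trans hST) h) (mul_lt_mul_of_pos_right hST h)
  have hmono : ∀ S T x, 0 < S → S ≤ T →
      g (S * u x) * (u x) ^ 2 ≤ g (T * u x) * (u x) ^ 2 := by
    intro S T x hS hST
    rcases hST.eq_or_lt with rfl | hST
    · rfl
    by_cases hx : u x = 0
    · simp [hx]
    · exact (hlt S T x hS hST hx).le
  have hIlt : ∀ S T : ℝ, 0 < S → S < T →
      ∫ x, g (S * u x) * (u x) ^ 2 ∂μ < ∫ x, g (T * u x) * (u x) ^ 2 ∂μ := by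
    intro S T hS hST
    rw [← sub_pos, ← integral_sub (hI T (hS.trans hST)) (hI S hS)]
    rw [integral_pos_iff_support_of_nonneg
      (fun x => sub_nonneg.2 (hmono S T x hS hST.le)) ((hI T (hS.trans hST)).sub (hI S hS))]
    refine hpos.trans_le (measure_mono ?_)
    intro x hx
    exact (sub_pos.2 (hlt S T x hS hST hx)).ne'
  obtain ⟨R, hR1, hRa, hRb⟩ : ∃ R : ℝ, 1 ≤ R ∧ c * K / A ≤ R ^ (p - 2) ∧ A / (C * K) ≤ R ^ (p - 2) := by
    have h := tendsto_rpow_atTop (show 0 < p - 2 by linarith)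
    obtain ⟨R, h1, h2, h3⟩ := ((Filter.eventually_ge_atTop (1:ℝ)).and
      ((h.eventually_ge_atTop (c * K / A)).and (h.eventually_ge_atTop (A / (C * K))))).exists
    exact ⟨R, h1, h2, h3⟩
  have hR : 0 < R := by linarith
  have hRi : 0 < R⁻¹ := inv_pos.2 hR
  have hRi1 : R⁻¹ ≤ 1 := inv_le_one_of_one_le₀ hR1
  have hpow : ∀ T : ℝ, 0 < T → T ^ p / T ^ 2 = T ^ (p - 2) := by
    intro T hT
    rw [rpow_sub hT]; norm_num
  have hlo : ∫ x, g (R⁻¹ * u x) * (u x) ^ 2 ∂μ ≤ A := by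
    have h := integral_mono (hI _ hRi) (hint.const_mul _)
      (hle R⁻¹ (R⁻¹ ^ p) hRi le_rfl (rpow_le_rpow_of_exponent_ge hRi hRi1 hpq.le))
    rw [integral_const_mul, mul_div_assoc, hpow _ hRi, inv_rpow hR.le] at h
    refine h.trans ?_
    have hRp : 0 < R ^ (p - 2) := by positivity
    rw [div_le_iff₀ hA] at hRa
    change c * (R ^ (p - 2))⁻¹ * K ≤ A
    rw [mul_right_comm, ← div_eq_mul_inv, div_le_iff₀ hRp]
    linarith
  have hhi : A ≤ ∫ x, g (R * u x) * (u x) ^ 2 ∂μ := by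
    have h := integral_mono (hint.const_mul _) (hI _ hR)
      (hge R (R ^ p) hR (by positivity) le_rfl (rpow_le_rpow_of_exponent_le hR1 hpq.le))
    rw [integral_const_mul, mul_div_assoc, hpow _ hR] at h
    refine le_trans ?_ h
    rw [div_le_iff₀ (by positivity)] at hRb
    change A ≤ C * R ^ (p - 2) * K
    linarith
  have hco : ContinuousOn (fun T : ℝ => ∫ x, g (T * u x) * (u x) ^ 2 ∂μ) (Set.Icc R⁻¹ R) := by
    refine continuousOn_of_dominated (bound := fun x => g (R * u x) * (u x) ^ 2) ?_ ?_ (hI R hR) ?_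
    · exact fun T _ => (hmeas T).aestronglyMeasurable
    · intro T hT
      have hT0 : 0 < T := hRi.trans_le hT.1
      refine Filter.Eventually.of_forall fun x => ?_
      rw [Real.norm_eq_abs, abs_of_nonneg (hnn T hT0 x)]
      exact hmono T R x hT0 hT.2
    · refine Filter.Eventually.of_forall fun x T hT => ?_
      have hT0 : 0 < T := hRi.trans_le hT.1
      by_cases hx : u x = 0
      · simp only [hx]
        simpa using continuousWithinAt_const
      · apply ContinuousAt.continuousWithinAt
        refine ContinuousAt.mul ?_ continuousAt_const
        exact ContinuousAt.comp (f := fun T : ℝ => T * u x) (hcont _ (mul_ne_zero hT0.ne' hx))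
          (by fun_prop)
  obtain ⟨T, hT, hTA⟩ := intermediate_value_Icc (hRi1.trans hR1) hco ⟨hlo, hhi⟩
  refine ⟨T, ⟨hRi.trans_le hT.1, hTA⟩, ?_⟩
  rintro S ⟨hS, hSA⟩
  have hT0 : 0 < T := hRi.trans_le hT.1
  simp only at hTA
  rcases lt_trichotomy S T with h | h | h
  · have := hIlt S T hS h; linarith
  · exact h
  · have := hIlt T S hT0 h; linarith

/-- For every `A > 0` there is a unique `T > 0` with `∫ f''(T·u)·u² = A`
(the ray through `u` meets `𝒱` in exactly one point). -/
theorem stmt8 (N : ℕ) (hN : 0 < N)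
    (f : ℝ → ℝ) (p q c₀ c₂ μ₁ μ₂ : ℝ)
    (hf_even : ∀ s : ℝ, f (-s) = f s) (hf_C1 : ContDiff ℝ 1 f)
    (hf0 : f 0 = 0) (hf'0 : deriv f 0 = 0)
    (hf_diff2 : ∀ s : ℝ, s ≠ 0 → DifferentiableAt ℝ (deriv f) s)
    (hf_diff3 : ∀ s : ℝ, s ≠ 0 → DifferentiableAt ℝ (deriv (deriv f)) s)
    (hc₀ : 0 < c₀) (hc₂ : 0 < c₂) (hp : 2 < p) (hpq : p < q)
    (hμ₁ : 2 < μ₁) (hμ₂ : 1 < μ₂)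
    (hf_low1 : ∀ s : ℝ, 1 ≤ |s| → c₀ * |s| ^ p ≤ f s)
    (hf_low2 : ∀ s : ℝ, |s| ≤ 1 → c₀ * |s| ^ q ≤ f s)
    (hf2_1 : ∀ s : ℝ, 1 ≤ |s| → |deriv (deriv f) s| ≤ c₂ * |s| ^ (p - 2))
    (hf2_2 : ∀ s : ℝ, 0 < |s| → |s| ≤ 1 → |deriv (deriv f) s| ≤ c₂ * |s| ^ (q - 2))
    (hfμ1 : ∀ s : ℝ, s ≠ 0 → 0 < μ₁ * f s ∧ μ₁ * f s ≤ s * deriv f s)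
    (hfμ2 : ∀ s : ℝ, s ≠ 0 → μ₂ * (s * deriv f s) < s ^ 2 * deriv (deriv f) s)
    (hfμ3 : ∀ s : ℝ, s ≠ 0 → 0 < s ^ 3 * deriv (deriv (deriv f)) s)
    (u : EuclideanSpace ℝ (Fin N) → ℝ) (hu_meas : Measurable u)
    (hu_pos : 0 < volume {x | u x ≠ 0})
    (hu_p : IntegrableOn (fun x => |u x| ^ p) {x | 1 ≤ |u x|})
    (hu_q : IntegrableOn (fun x => |u x| ^ q) {x | |u x| < 1}) :
    ∀ A : ℝ, 0 < A →
      ∃! T : ℝ, 0 < T ∧ ∫ x, deriv (deriv f) (T * u x) * (u x) ^ 2 = A := by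
  intro A hA
  have hk1 : ∀ s : ℝ, 1 ≤ |s| → min (|s| ^ p) (|s| ^ q) = |s| ^ p := fun s hs =>
    min_eq_left (rpow_le_rpow_of_exponent_le hs hpq.le)
  have hk2 : ∀ s : ℝ, |s| ≤ 1 → min (|s| ^ p) (|s| ^ q) = |s| ^ q := fun s hs => by
    rcases (abs_nonneg s).eq_or_lt with h | h
    · rw [← h, zero_rpow (by linarith), zero_rpow (by linarith), min_self]
    · exact min_eq_right (rpow_le_rpow_of_exponent_ge h hs hpq.le)
  have hpw : ∀ s r : ℝ, s ≠ 0 → |s| ^ (r - 2) * s ^ 2 = |s| ^ r := by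
    intro s r hs
    have h : 0 < |s| := abs_pos.2 hs
    rw [rpow_sub h, ← sq_abs s]
    norm_num
    field_simp
  refine aux_main_s8 volume (deriv (deriv f)) (measurable_deriv _) p q c₂ (μ₂ * μ₁ * c₀) hp hpq hc₂
    (by positivity) ?_ ?_ (fun s hs => (hf_diff3 s hs).continuousAt) ?_ ?_ u hu_meas hu_pos ?_ A hA
  · intro s
    by_cases hs : s = 0
    · subst hs
      simp [zero_rpow (show p ≠ 0 by linarith), zero_rpow (show q ≠ 0 by linarith)]
    rcases le_total 1 |s| with h | h
    · rw [hk1 s h, ← hpw s p hs, ← mul_assoc]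
      exact mul_le_mul_of_nonneg_right ((le_abs_self _).trans (hf2_1 s h)) (sq_nonneg s)
    · rw [hk2 s h, ← hpw s q hs, ← mul_assoc]
      exact mul_le_mul_of_nonneg_right
        ((le_abs_self _).trans (hf2_2 s (abs_pos.2 hs) h)) (sq_nonneg s)
  · intro s
    by_cases hs : s = 0
    · subst hs
      simp [zero_rpow (show p ≠ 0 by linarith), zero_rpow (show q ≠ 0 by linarith)]
    have hf : c₀ * min (|s| ^ p) (|s| ^ q) ≤ f s := by
      rcases le_total 1 |s| with h | h
      · rw [hk1 s h]; exact hf_low1 s h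
      · rw [hk2 s h]; exact hf_low2 s h
    have h1 := (hfμ1 s hs).2
    have h2 := hfμ2 s hs
    have h3 : μ₁ * (c₀ * min (|s| ^ p) (|s| ^ q)) ≤ s * deriv f s :=
      (mul_le_mul_of_nonneg_left hf (by linarith)).trans h1
    have h4 := mul_le_mul_of_nonneg_left h3 (show 0 ≤ μ₂ by linarith)
    linarith
  · refine strictMonoOn_of_deriv_pos (convex_Ioi 0)
      (fun s hs => (hf_diff3 s (ne_of_gt hs)).continuousAt.continuousWithinAt) ?_
    intro s hs
    rw [interior_Ioi] at hs
    have hs' : 0 < s := hs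
    exact pos_of_mul_pos_right (hfμ3 s hs'.ne') (by positivity)
  · refine strictAntiOn_of_deriv_neg (convex_Iio 0)
      (fun s hs => (hf_diff3 s (ne_of_lt hs)).continuousAt.continuousWithinAt) ?_
    intro s hs
    rw [interior_Iio] at hs
    have hs' : s < 0 := hs
    have h3 : s ^ 3 < 0 := Odd.pow_neg (by decide) hs'
    by_contra hcon
    have := mul_nonpos_of_nonpos_of_nonneg h3.le (not_lt.1 hcon)
    linarith [hfμ3 s hs'.ne]
  · have hms : MeasurableSet {x | 1 ≤ |u x|} := measurableSet_le measurable_const (by fun_prop)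
    have hms' : MeasurableSet {x | |u x| < 1} := measurableSet_lt (by fun_prop) measurable_const
    rw [← integrableOn_univ]
    have huniv : (Set.univ : Set (EuclideanSpace ℝ (Fin N))) = {x | 1 ≤ |u x|} ∪ {x | |u x| < 1} := by
      ext x; simp [le_or_gt]
    rw [huniv]
    refine IntegrableOn.union (hu_p.congr_fun (fun x hx => (hk1 _ hx).symm) hms)
      (hu_q.congr_fun (fun x hx => (hk2 _ (le_of_lt hx)).symm) hms')
end

section
/- For every real number A > 0 there exists a unique t⁰ > 0 such that t⁰·A = ∫_{ℝ^N} f'(t⁰·u(x))·u(x) dx; moreover, for every s ≥ 0 one has (s²/2)·A − ∫_{ℝ^N} f(s·u) dx ≤ ((t⁰)²/2)·A − ∫_{ℝ^N} f(t⁰·u) dx. (This is the case ∫gu = 0 of the structure of the Nehari manifold: the ray through u meets 𝒩₀ in exactly one point, which maximizes the energy along the ray.) -/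
open Real MeasureTheory Filter

/-- ratio monotonicity -/
lemma aux_mono (g : ℝ → ℝ) (m : ℝ)
    (hd : ∀ s : ℝ, 0 < s → DifferentiableAt ℝ g s)
    (hm : ∀ s : ℝ, 0 < s → m * g s ≤ s * deriv g s) :
    MonotoneOn (fun s => g s * s ^ (-m)) (Set.Ioi 0) := by
  have hder : ∀ s : ℝ, 0 < s → HasDerivAt (fun s => g s * s ^ (-m))
      (deriv g s * s ^ (-m) + g s * (-m * s ^ (-m - 1))) s := by
    intro s hs
    exact (hd s hs).hasDerivAt.mul (Real.hasDerivAt_rpow_const (Or.inl hs.ne'))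
  apply monotoneOn_of_deriv_nonneg (convex_Ioi 0)
  · intro s hs
    exact (hder s hs).continuousAt.continuousWithinAt
  · intro s hs
    rw [interior_Ioi] at hs
    exact (hder s hs).differentiableAt.differentiableWithinAt
  · intro s hs
    rw [interior_Ioi] at hs
    have hs' : 0 < s := hs
    rw [(hder s hs).deriv]
    have e : s ^ (-m) = s ^ (-m - 1) * s := by
      rw [← Real.rpow_add_one hs'.ne']; ring_nf
    rw [e]
    have h1 := hm s hs'
    have h2 : 0 < s ^ (-m - 1) := Real.rpow_pos_of_pos hs' _
    nlinarith [mul_nonneg h2.le (sub_nonneg.2 h1)]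

lemma aux_scale (g : ℝ → ℝ) (m : ℝ)
    (hd : ∀ s : ℝ, 0 < s → DifferentiableAt ℝ g s)
    (hm : ∀ s : ℝ, 0 < s → m * g s ≤ s * deriv g s) (r x : ℝ) (hr : 1 ≤ r) (hx : 0 < x) :
    r ^ m * g x ≤ g (r * x) := by
  have hr0 : 0 < r := by linarith
  have h := aux_mono g m hd hm (Set.mem_Ioi.2 hx) (Set.mem_Ioi.2 (mul_pos hr0 hx))
    (by nlinarith)
  simp only at h
  rw [Real.mul_rpow hr0.le hx.le, Real.rpow_neg hr0.le, Real.rpow_neg hx.le] at h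
  have h1 : 0 < r ^ m := Real.rpow_pos_of_pos hr0 _
  have h2 : 0 < x ^ m := Real.rpow_pos_of_pos hx _
  have h3 : r ^ m * x ^ m * (g x * (x ^ m)⁻¹) ≤
      r ^ m * x ^ m * (g (r * x) * ((r ^ m)⁻¹ * (x ^ m)⁻¹)) :=
    mul_le_mul_of_nonneg_left h (by positivity)
  have e1 : r ^ m * x ^ m * (g x * (x ^ m)⁻¹) = r ^ m * g x := by field_simp
  have e2 : r ^ m * x ^ m * (g (r * x) * ((r ^ m)⁻¹ * (x ^ m)⁻¹)) = g (r * x) := by field_simp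
  rwa [e1, e2] at h3

/-- pointwise fibre inequality -/
lemma aux_fib (f : ℝ → ℝ) (hf : Differentiable ℝ f)
    (hmono : ∀ a b : ℝ, 0 < a → a ≤ b → deriv f a * b ≤ deriv f b * a)
    (a b : ℝ) (ha : 0 < a) (hb : 0 ≤ b) :
    (b ^ 2 - a ^ 2) / 2 * (deriv f a / a) ≤ f b - f a := by
  set k := deriv f a / a with hk
  have hder : ∀ s : ℝ, HasDerivAt (fun s => f s - s ^ 2 / 2 * k) (deriv f s - s * k) s := by
    intro s
    have h1 : HasDerivAt (fun s : ℝ => s ^ 2 / 2 * k) (s * k) s := by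
      have h2 := ((hasDerivAt_pow 2 s).div_const 2).mul_const k
      have e : ((2 : ℕ) : ℝ) * s ^ (2 - 1) / 2 * k = s * k := by
        push_cast; ring
      rw [e] at h2
      exact h2
    exact (hf s).hasDerivAt.sub h1
  have hcont : Continuous (fun s => f s - s ^ 2 / 2 * k) :=
    continuous_iff_continuousAt.2 fun s => (hder s).continuousAt
  have hdf : Differentiable ℝ (fun s => f s - s ^ 2 / 2 * k) :=
    fun s => (hder s).differentiableAt
  have key : f a - a ^ 2 / 2 * k ≤ f b - b ^ 2 / 2 * k := by
    rcases le_total a b with hab | hab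
    · have : MonotoneOn (fun s => f s - s ^ 2 / 2 * k) (Set.Ici a) := by
        apply monotoneOn_of_deriv_nonneg (convex_Ici a) hcont.continuousOn hdf.differentiableOn
        intro s hs
        rw [interior_Ici] at hs
        rw [(hder s).deriv, hk, sub_nonneg, ← mul_div_assoc, div_le_iff₀ ha]
        have := hmono a s ha (le_of_lt hs)
        linarith
      exact this (Set.mem_Ici.2 le_rfl) (Set.mem_Ici.2 hab) hab
    · have : AntitoneOn (fun s => f s - s ^ 2 / 2 * k) (Set.Icc 0 a) := by
        apply antitoneOn_of_deriv_nonpos (convex_Icc 0 a) hcont.continuousOn hdf.differentiableOn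
        intro s hs
        rw [interior_Icc] at hs
        rw [(hder s).deriv, hk, sub_nonpos, ← mul_div_assoc, le_div_iff₀ ha]
        have := hmono s a hs.1 hs.2.le
        linarith
      exact this ⟨hb, hab⟩ ⟨ha.le, le_rfl⟩ hab
  linarith

/-- abstract fibre root -/
lemma aux_root (K : ℝ → ℝ) (m A : ℝ) (hm : 1 < m) (hA : 0 < A)
    (hc : ContinuousOn K (Set.Ioi 0)) (hpos : ∀ t, 0 < t → 0 < K t)
    (hs : ∀ r t : ℝ, 1 ≤ r → 0 < t → r ^ (m + 1) * K t ≤ K (r * t)) :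
    ∃! t : ℝ, 0 < t ∧ t ^ 2 * A = K t := by
  have hQ : ∀ r t : ℝ, 1 ≤ r → 0 < t → r ^ (m - 1) * (K t / t ^ 2) ≤ K (r * t) / (r * t) ^ 2 := by
    intro r t hr ht
    have hr0 : 0 < r := by linarith
    have h := hs r t hr ht
    have e : r ^ (m + 1) = r ^ (m - 1) * r ^ 2 := by
      rw [← Real.rpow_natCast r 2, ← Real.rpow_add hr0]; congr 1; push_cast; ring
    rw [e] at h
    rw [le_div_iff₀ (by positivity)]
    have : r ^ (m - 1) * (K t / t ^ 2) * (r * t) ^ 2 = r ^ (m - 1) * r ^ 2 * K t := by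
      field_simp
    rw [this]; exact h
  have hQpos : ∀ t, 0 < t → 0 < K t / t ^ 2 := fun t ht => div_pos (hpos t ht) (by positivity)
  have hstrict : ∀ s t : ℝ, 0 < s → s < t → K s / s ^ 2 < K t / t ^ 2 := by
    intro s t h0 hst
    have h1 : 1 < t / s := (one_lt_div h0).2 hst
    have h := hQ (t / s) s h1.le h0
    rw [div_mul_cancel₀ _ h0.ne'] at h
    have h2 : 1 < (t / s) ^ (m - 1) := Real.one_lt_rpow h1 (by linarith)
    nlinarith [hQpos s h0]
  have hiff : ∀ t, 0 < t → (t ^ 2 * A = K t ↔ K t / t ^ 2 = A) := by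
    intro t ht
    rw [div_eq_iff (by positivity)]
    constructor <;> intro h <;> linarith
  set Q1 := K 1 / 1 ^ 2 with hQ1
  have hQ1pos : 0 < Q1 := hQpos 1 one_pos
  set M := max 1 (max (A / Q1) (Q1 / A)) with hM
  have hM1 : 1 ≤ M := le_max_left _ _
  have hM2 : A / Q1 ≤ M := (le_max_left _ _).trans (le_max_right _ _)
  have hM3 : Q1 / A ≤ M := (le_max_right _ _).trans (le_max_right _ _)
  set r := M ^ (1 / (m - 1)) with hr
  have hr1 : 1 ≤ r := Real.one_le_rpow hM1 (by apply div_nonneg <;> linarith)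
  have hr0 : 0 < r := by linarith
  have hrM : r ^ (m - 1) = M := by
    rw [hr, ← Real.rpow_mul (by linarith), one_div, inv_mul_cancel₀ (by linarith), Real.rpow_one]
  have hup : A ≤ K r / r ^ 2 := by
    have h := hQ r 1 hr1 one_pos
    rw [hrM, mul_one, ← hQ1] at h
    rw [div_le_iff₀ hQ1pos] at hM2
    linarith
  have hlo : K (r⁻¹) / (r⁻¹) ^ 2 ≤ A := by
    have h := hQ r r⁻¹ hr1 (by positivity)
    rw [hrM, mul_inv_cancel₀ hr0.ne', ← hQ1] at h
    rw [div_le_iff₀ hA] at hM3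
    have : M * (K (r⁻¹) / (r⁻¹) ^ 2) ≤ M * A := h.trans hM3
    exact le_of_mul_le_mul_left this (by linarith)
  have hle : r⁻¹ ≤ r := (inv_le_one_of_one_le₀ hr1).trans hr1
  have hsub : Set.Icc r⁻¹ r ⊆ Set.Ioi 0 := fun t ht => lt_of_lt_of_le (by positivity) ht.1
  have hcQ : ContinuousOn (fun t => K t / t ^ 2) (Set.Icc r⁻¹ r) := by
    apply (hc.mono hsub).div (by fun_prop)
    intro t ht
    have : 0 < t := hsub ht
    positivity
  obtain ⟨t, ht, hte⟩ := intermediate_value_Icc hle hcQ ⟨hlo, hup⟩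
  have ht0 : 0 < t := hsub ht
  refine ⟨t, ⟨ht0, (hiff t ht0).2 hte⟩, ?_⟩
  rintro s ⟨hs0, hse⟩
  rw [hiff s hs0] at hse
  simp only at hte
  rcases lt_trichotomy s t with h | h | h
  · have := hstrict s t hs0 h; linarith
  · exact h
  · have := hstrict t s ht0 h; linarith

theorem stmt10 (N : ℕ) (hN : 0 < N)
    (f : ℝ → ℝ) (p q c₀ c₂ μ₁ μ₂ : ℝ)
    (hf_even : ∀ s : ℝ, f (-s) = f s) (hf_C1 : ContDiff ℝ 1 f)
    (hf0 : f 0 = 0) (hf'0 : deriv f 0 = 0)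
    (hf_diff2 : ∀ s : ℝ, s ≠ 0 → DifferentiableAt ℝ (deriv f) s)
    (hf_diff3 : ∀ s : ℝ, s ≠ 0 → DifferentiableAt ℝ (deriv (deriv f)) s)
    (hc₀ : 0 < c₀) (hc₂ : 0 < c₂) (hp : 2 < p) (hpq : p < q)
    (hμ₁ : 2 < μ₁) (hμ₂ : 1 < μ₂)
    (hf_low1 : ∀ s : ℝ, 1 ≤ |s| → c₀ * |s| ^ p ≤ f s)
    (hf_low2 : ∀ s : ℝ, |s| ≤ 1 → c₀ * |s| ^ q ≤ f s)
    (hf2_1 : ∀ s : ℝ, 1 ≤ |s| → |deriv (deriv f) s| ≤ c₂ * |s| ^ (p - 2))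
    (hf2_2 : ∀ s : ℝ, 0 < |s| → |s| ≤ 1 → |deriv (deriv f) s| ≤ c₂ * |s| ^ (q - 2))
    (hfμ1 : ∀ s : ℝ, s ≠ 0 → 0 < μ₁ * f s ∧ μ₁ * f s ≤ s * deriv f s)
    (hfμ2 : ∀ s : ℝ, s ≠ 0 → μ₂ * (s * deriv f s) < s ^ 2 * deriv (deriv f) s)
    (hfμ3 : ∀ s : ℝ, s ≠ 0 → 0 < s ^ 3 * deriv (deriv (deriv f)) s)
    (u : EuclideanSpace ℝ (Fin N) → ℝ) (hu_meas : Measurable u)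
    (hu_pos : 0 < volume {x | u x ≠ 0})
    (hu_p : IntegrableOn (fun x => |u x| ^ p) {x | 1 ≤ |u x|})
    (hu_q : IntegrableOn (fun x => |u x| ^ q) {x | |u x| < 1})
    (A : ℝ) (hA : 0 < A) :
    (∃! t0 : ℝ, 0 < t0 ∧ t0 * A = ∫ x, deriv f (t0 * u x) * u x) ∧
    (∀ t0 : ℝ, 0 < t0 → t0 * A = (∫ x, deriv f (t0 * u x) * u x) →
      ∀ s : ℝ, 0 ≤ s →
        s ^ 2 / 2 * A - (∫ x, f (s * u x)) ≤
          t0 ^ 2 / 2 * A - ∫ x, f (t0 * u x)) := by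
  have hfd : Differentiable ℝ f := hf_C1.differentiable one_ne_zero
  have hf'c : Continuous (deriv f) := hf_C1.continuous_deriv le_rfl
  have hodd : ∀ s, deriv f (-s) = - deriv f s := by
    intro s
    have h1 : (fun x => f (-x)) = f := funext hf_even
    have h2 := deriv_comp_neg f s
    rw [h1] at h2
    linarith
  set h : ℝ → ℝ := fun s => s * deriv f s with hh
  have hheven : ∀ s, h (-s) = h s := by
    intro s; simp only [hh, hodd]; ring
  have hhabs : ∀ s, h |s| = h s := by
    intro s
    rcases abs_choice s with e | e <;> rw [e]
    exact hheven s
  have hfabs : ∀ s, f |s| = f s := by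
    intro s
    rcases abs_choice s with e | e <;> rw [e]
    exact hf_even s
  have hhc : Continuous h := continuous_id.mul hf'c
  have hh0 : h 0 = 0 := by simp [hh]
  have hhpos : ∀ s, s ≠ 0 → 0 < h s := fun s hs =>
    lt_of_lt_of_le (hfμ1 s hs).1 (hfμ1 s hs).2
  have hhnn : ∀ s, 0 ≤ h s := by
    intro s
    by_cases hs : s = 0
    · rw [hs, hh0]
    · exact (hhpos s hs).le
  have hfnn : ∀ s, 0 ≤ f s := by
    intro s
    by_cases hs : s = 0
    · rw [hs, hf0]
    · have := (hfμ1 s hs).1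
      exact (pos_of_mul_pos_right this (by linarith)).le
  have hfh : ∀ s, f s ≤ h s := by
    intro s
    by_cases hs : s = 0
    · rw [hs, hf0, hh0]
    · have h1 := (hfμ1 s hs).2
      have h2 := hfnn s
      have : f s ≤ μ₁ * f s := by nlinarith
      exact this.trans h1
  -- growth bound
  have hbd : ∀ s, h s ≤ c₂ * min (|s| ^ p) (|s| ^ q) := by
    intro s
    by_cases hs : s = 0
    · rw [hs, hh0]; positivity
    have hs0 : 0 < |s| := abs_pos.2 hs
    have h1 : h s ≤ s ^ 2 * |deriv (deriv f) s| := by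
      have h2 := hfμ2 s hs
      have h3 := hhpos s hs
      have h4 : h s ≤ μ₂ * h s := by nlinarith
      have h5 : s ^ 2 * deriv (deriv f) s ≤ s ^ 2 * |deriv (deriv f) s| :=
        mul_le_mul_of_nonneg_left (le_abs_self _) (sq_nonneg s)
      exact h4.trans (h2.le.trans h5)
    have e : ∀ y : ℝ, s ^ 2 * (c₂ * |s| ^ (y - 2)) = c₂ * |s| ^ y := by
      intro y
      have : |s| ^ y = |s| ^ (y - 2) * |s| ^ 2 := by
        rw [← Real.rpow_natCast |s| 2, ← Real.rpow_add hs0]; congr 1; push_cast; ring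
      rw [this, sq_abs]; ring
    rcases le_total 1 |s| with h2 | h2
    · rw [min_eq_left (Real.rpow_le_rpow_of_exponent_le h2 hpq.le), ← e p]
      exact h1.trans (mul_le_mul_of_nonneg_left (hf2_1 s h2) (sq_nonneg s))
    · rw [min_eq_right (Real.rpow_le_rpow_of_exponent_ge hs0 h2 hpq.le), ← e q]
      exact h1.trans (mul_le_mul_of_nonneg_left (hf2_2 s hs0 h2) (sq_nonneg s))
  -- scaling
  have hsc : ∀ r x : ℝ, 1 ≤ r → r ^ (μ₂ + 1) * h x ≤ h (r * x) := by
    intro r x hr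
    have hr0 : 0 < r := by linarith
    by_cases hx : x = 0
    · simp [hx, hh0]
    have hx0 : 0 < |x| := abs_pos.2 hx
    have h1 := aux_scale (deriv f) μ₂ (fun s hs => hf_diff2 s hs.ne') (by
      intro s hs
      have := hfμ2 s hs.ne'
      have h3 : s * (μ₂ * deriv f s) ≤ s * (s * deriv (deriv f) s) := by nlinarith
      exact le_of_mul_le_mul_left h3 hs) r |x| hr hx0
    rw [← hhabs x, ← hhabs (r * x), abs_mul, abs_of_pos hr0, Real.rpow_add_one hr0.ne']
    simp only [hh]
    have := mul_le_mul_of_nonneg_left h1 (mul_pos hr0 hx0).le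
    linarith
  have hm1 : ∀ a b : ℝ, 0 < a → a ≤ b → deriv f a * b ≤ deriv f b * a := by
    intro a b ha hab
    have h1 := aux_scale (deriv f) 1 (fun s hs => hf_diff2 s hs.ne') (by
      intro s hs
      have := hfμ2 s hs.ne'
      have h4 : 0 < s * deriv f s := hhpos s hs.ne'
      have h3 : s * (1 * deriv f s) ≤ s * (s * deriv (deriv f) s) := by nlinarith
      exact le_of_mul_le_mul_left h3 hs) (b / a) a ((one_le_div ha).2 hab) ha
    rw [div_mul_cancel₀ _ ha.ne', Real.rpow_one, div_mul_eq_mul_div, div_le_iff₀ ha] at h1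
    linarith
  have hfib : ∀ t s x : ℝ, 0 < t → 0 ≤ s →
      (s ^ 2 - t ^ 2) / (2 * t ^ 2) * h (t * x) ≤ f (s * x) - f (t * x) := by
    intro t s x ht hs
    by_cases hx : x = 0
    · simp [hx, hh0]
    have hx0 : 0 < |x| := abs_pos.2 hx
    have h1 := aux_fib f hfd hm1 (t * |x|) (s * |x|) (by positivity) (by positivity)
    rw [← hhabs (t * x), ← hfabs (s * x), ← hfabs (t * x), abs_mul, abs_mul, abs_of_pos ht,
      abs_of_nonneg hs]
    refine le_trans (le_of_eq ?_) h1
    simp only [hh]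
    field_simp
  -- integrability
  set m : EuclideanSpace ℝ (Fin N) → ℝ := fun x => min (|u x| ^ p) (|u x| ^ q) with hmdef
  have hmnn : ∀ x, 0 ≤ m x := fun x => by positivity
  have hmint : Integrable m := by
    rw [← integrableOn_univ]
    have hU : (Set.univ : Set (EuclideanSpace ℝ (Fin N))) = {x | 1 ≤ |u x|} ∪ {x | |u x| < 1} := by
      ext x; simp [le_or_gt]
    have hmm : Measurable m := by fun_prop
    rw [hU]
    refine IntegrableOn.union ?_ ?_
    · refine Integrable.mono' hu_p hmm.aestronglyMeasurable (Eventually.of_forall fun x => ?_)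
      rw [Real.norm_of_nonneg (hmnn x)]; exact min_le_left _ _
    · refine Integrable.mono' hu_q hmm.aestronglyMeasurable (Eventually.of_forall fun x => ?_)
      rw [Real.norm_of_nonneg (hmnn x)]; exact min_le_right _ _
  have hdom : ∀ R t : ℝ, 0 ≤ t → t ≤ R → ∀ x, h (t * u x) ≤ c₂ * (max (R ^ p) (R ^ q) * m x) := by
    intro R t ht htR x
    have hR : 0 ≤ R := ht.trans htR
    refine (hbd _).trans (mul_le_mul_of_nonneg_left ?_ hc₂.le)
    rw [abs_mul, abs_of_nonneg ht, Real.mul_rpow ht (abs_nonneg _),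
      Real.mul_rpow ht (abs_nonneg _)]
    have h1 : t ^ p ≤ R ^ p := Real.rpow_le_rpow ht htR (by linarith)
    have h2 : t ^ q ≤ R ^ q := Real.rpow_le_rpow ht htR (by linarith)
    rw [mul_min_of_nonneg _ _ (by positivity)]
    apply min_le_min
    · exact mul_le_mul_of_nonneg_right (h1.trans (le_max_left _ _)) (by positivity)
    · exact mul_le_mul_of_nonneg_right (h2.trans (le_max_right _ _)) (by positivity)
  have hdomint : ∀ R : ℝ, Integrable (fun x => c₂ * (max (R ^ p) (R ^ q) * m x)) := fun R =>
    (hmint.const_mul _).const_mul _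
  have hhm : ∀ t : ℝ, Measurable (fun x => h (t * u x)) := fun t =>
    hhc.measurable.comp (hu_meas.const_mul t)
  have hhint : ∀ t : ℝ, 0 ≤ t → Integrable (fun x => h (t * u x)) := by
    intro t ht
    refine (hdomint t).mono' (hhm t).aestronglyMeasurable (Eventually.of_forall fun x => ?_)
    rw [Real.norm_of_nonneg (hhnn _)]
    exact hdom t t ht le_rfl x
  have hfint : ∀ t : ℝ, 0 ≤ t → Integrable (fun x => f (t * u x)) := by
    intro t ht
    refine (hhint t ht).mono' (hfd.continuous.measurable.comp
      (hu_meas.const_mul t)).aestronglyMeasurable (Eventually.of_forall fun x => ?_)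
    rw [Real.norm_of_nonneg (hfnn _)]
    exact hfh _
  set K : ℝ → ℝ := fun t => ∫ x, h (t * u x) with hK
  have hKpos : ∀ t, 0 < t → 0 < K t := by
    intro t ht
    simp only [hK]
    rw [integral_pos_iff_support_of_nonneg (fun x => hhnn _) (hhint t ht.le)]
    refine lt_of_lt_of_le hu_pos (measure_mono fun x hx => ?_)
    exact (hhpos _ (mul_ne_zero ht.ne' hx)).ne'
  have hKs : ∀ r t : ℝ, 1 ≤ r → 0 < t → r ^ (μ₂ + 1) * K t ≤ K (r * t) := by
    intro r t hr ht
    simp only [hK]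
    rw [← integral_const_mul]
    refine integral_mono ((hhint t ht.le).const_mul _) (hhint (r * t) (by positivity)) fun x => ?_
    have := hsc r (t * u x) hr
    simp only [mul_assoc]
    exact this
  have hKc : ContinuousOn K (Set.Ioi 0) := by
    intro t ht
    have ht0 : 0 < t := ht
    apply ContinuousAt.continuousWithinAt
    refine continuousAt_of_dominated (bound := fun x => c₂ * (max ((t + 1) ^ p) ((t + 1) ^ q) * m x))
      (Eventually.of_forall fun s => (hhm s).aestronglyMeasurable) ?_ (hdomint _) ?_
    · filter_upwards [Ioo_mem_nhds ht0 (lt_add_one t)] with s hs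
      refine Eventually.of_forall fun x => ?_
      rw [Real.norm_of_nonneg (hhnn _)]
      exact hdom _ _ hs.1.le hs.2.le x
    · refine Eventually.of_forall fun x => ?_
      exact (hhc.comp (continuous_id.mul continuous_const)).continuousAt
  have heq : ∀ t, 0 < t → (t * A = (∫ x, deriv f (t * u x) * u x) ↔ t ^ 2 * A = K t) := by
    intro t ht
    have e : K t = t * ∫ x, deriv f (t * u x) * u x := by
      simp only [hK]
      rw [← integral_const_mul]
      congr 1; ext x; simp only [hh]; ring
    rw [e, pow_two, mul_assoc]
    exact (mul_right_inj' ht.ne').symm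
  constructor
  · obtain ⟨t, ⟨ht0, hte⟩, huniq⟩ := aux_root K μ₂ A hμ₂ hA hKc hKpos hKs
    refine ⟨t, ⟨ht0, (heq t ht0).2 hte⟩, ?_⟩
    rintro s ⟨hs0, hse⟩
    exact huniq s ⟨hs0, (heq s hs0).1 hse⟩
  · intro t ht hte s hs
    have h1 := (heq t ht).1 hte
    have h2 : ∫ x, (s ^ 2 - t ^ 2) / (2 * t ^ 2) * h (t * u x) ≤
        ∫ x, (f (s * u x) - f (t * u x)) :=
      integral_mono ((hhint t ht.le).const_mul _) ((hfint s hs).sub (hfint t ht.le))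
        fun x => hfib t s (u x) ht hs
    rw [integral_const_mul, integral_sub (hfint s hs) (hfint t ht.le)] at h2
    have h3 : (s ^ 2 - t ^ 2) / (2 * t ^ 2) * K t = (s ^ 2 - t ^ 2) / 2 * A := by
      rw [← h1]; field_simp
    have h4 : (s ^ 2 - t ^ 2) / 2 * A ≤ (∫ x, f (s * u x)) - ∫ x, f (t * u x) := h3 ▸ h2
    linarith
end

section
/- Let A > 0 and G < 0 be real numbers, and let t⁰ > 0 be the unique positive number with t⁰·A = ∫_{ℝ^N} f'(t⁰·u)·u dx. Then there exists a unique t¹ > 0 such that t¹·A = ∫_{ℝ^N} f'(t¹·u(x))·u(x) dx + G, and moreover t⁰ < t¹. (This is case 1 of Proposition 2.8 on the structure of the Nehari manifold, with G = ∫gu < 0.) -/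
open Real MeasureTheory Filter

theorem stmt11 (N : ℕ) (hN : 0 < N)
    (f : ℝ → ℝ) (p q c₀ c₂ μ₁ μ₂ : ℝ)
    (hf_even : ∀ s : ℝ, f (-s) = f s) (hf_C1 : ContDiff ℝ 1 f)
    (hf0 : f 0 = 0) (hf'0 : deriv f 0 = 0)
    (hf_diff2 : ∀ s : ℝ, s ≠ 0 → DifferentiableAt ℝ (deriv f) s)
    (hf_diff3 : ∀ s : ℝ, s ≠ 0 → DifferentiableAt ℝ (deriv (deriv f)) s)
    (hc₀ : 0 < c₀) (hc₂ : 0 < c₂) (hp : 2 < p) (hpq : p < q)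
    (hμ₁ : 2 < μ₁) (hμ₂ : 1 < μ₂)
    (hf_low1 : ∀ s : ℝ, 1 ≤ |s| → c₀ * |s| ^ p ≤ f s)
    (hf_low2 : ∀ s : ℝ, |s| ≤ 1 → c₀ * |s| ^ q ≤ f s)
    (hf2_1 : ∀ s : ℝ, 1 ≤ |s| → |deriv (deriv f) s| ≤ c₂ * |s| ^ (p - 2))
    (hf2_2 : ∀ s : ℝ, 0 < |s| → |s| ≤ 1 → |deriv (deriv f) s| ≤ c₂ * |s| ^ (q - 2))
    (hfμ1 : ∀ s : ℝ, s ≠ 0 → 0 < μ₁ * f s ∧ μ₁ * f s ≤ s * deriv f s)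
    (hfμ2 : ∀ s : ℝ, s ≠ 0 → μ₂ * (s * deriv f s) < s ^ 2 * deriv (deriv f) s)
    (hfμ3 : ∀ s : ℝ, s ≠ 0 → 0 < s ^ 3 * deriv (deriv (deriv f)) s)
    (u : EuclideanSpace ℝ (Fin N) → ℝ) (hu_meas : Measurable u)
    (hu_pos : 0 < volume {x | u x ≠ 0})
    (hu_p : IntegrableOn (fun x => |u x| ^ p) {x | 1 ≤ |u x|})
    (hu_q : IntegrableOn (fun x => |u x| ^ q) {x | |u x| < 1})
    (A G : ℝ) (hA : 0 < A) (hG : G < 0)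
    (t0 : ℝ) (ht0 : 0 < t0) (ht0eq : t0 * A = ∫ x, deriv f (t0 * u x) * u x) :
    (∃! t1 : ℝ, 0 < t1 ∧ t1 * A = (∫ x, deriv f (t1 * u x) * u x) + G) ∧
    (∀ t1 : ℝ, 0 < t1 → t1 * A = (∫ x, deriv f (t1 * u x) * u x) + G →
      t0 < t1) := by
  have hcd : Continuous (deriv f) := hf_C1.continuous_deriv le_rfl
  have hsf : ∀ s : ℝ, 0 ≤ s * deriv f s := by
    intro s
    rcases eq_or_ne s 0 with h | h
    · simp [h]
    · have := hfμ1 s h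
      linarith [this.1, this.2]
  have hnn : ∀ t s : ℝ, 0 < t → 0 ≤ deriv f (t * s) * s := by
    intro t s ht
    have h1 := hsf (t * s)
    have h2 : t * s * deriv f (t * s) = t * (deriv f (t * s) * s) := by ring
    rw [h2] at h1
    exact nonneg_of_mul_nonneg_right h1 ht
  -- pointwise monotonicity
  have hmono : ∀ s t t' : ℝ, 0 < t → t ≤ t' →
      (t' / t) ^ μ₂ * (deriv f (t * s) * s) ≤ deriv f (t' * s) * s := by
    intro s t t' ht htt'
    have ht' : 0 < t' := lt_of_lt_of_le ht htt'
    rcases eq_or_ne s 0 with h | h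
    · simp [h]
    have hder : ∀ x ∈ Set.Ioi (0:ℝ), HasDerivAt (fun x => deriv f (x * s) * s * x ^ (-μ₂))
        (deriv (deriv f) (x * s) * s * s * x ^ (-μ₂)
          + deriv f (x * s) * s * ((-μ₂) * x ^ (-μ₂ - 1))) x := by
      intro x hx
      have hx0 : x ≠ 0 := ne_of_gt hx
      have h1 : HasDerivAt (fun x : ℝ => x * s) s x := by
        simpa using (hasDerivAt_id x).mul_const s
      have h2 := (hf_diff2 (x * s) (mul_ne_zero hx0 h)).hasDerivAt
      have h3 : HasDerivAt (fun x : ℝ => deriv f (x * s)) (deriv (deriv f) (x * s) * s) x :=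
        HasDerivAt.comp (h₂ := deriv f) (h := fun x : ℝ => x * s) x h2 h1
      exact (h3.mul_const s).mul (Real.hasDerivAt_rpow_const (Or.inl hx0))
    have hM : MonotoneOn (fun x => deriv f (x * s) * s * x ^ (-μ₂)) (Set.Ioi (0:ℝ)) := by
      apply monotoneOn_of_deriv_nonneg (convex_Ioi 0)
      · intro x hx
        exact (hder x hx).continuousAt.continuousWithinAt
      · intro x hx
        rw [interior_Ioi] at hx
        exact (hder x hx).differentiableAt.differentiableWithinAt
      · intro x hx
        rw [interior_Ioi] at hx
        rw [(hder x hx).deriv]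
        have hx' : 0 < x := hx
        have hx0 : x ≠ 0 := ne_of_gt hx'
        have h4 := hfμ2 (x * s) (mul_ne_zero hx0 h)
        have e1 : x ^ (-μ₂) = x ^ (-μ₂ - 2) * x ^ 2 := by
          rw [← Real.rpow_natCast, ← Real.rpow_add hx']; congr 1; push_cast; ring
        have e2 : x ^ (-μ₂ - 1) = x ^ (-μ₂ - 2) * x := by
          nth_rewrite 3 [← Real.rpow_one x]
          rw [← Real.rpow_add hx']; congr 1; ring
        rw [e1, e2]
        have h5 : 0 < x ^ (-μ₂ - 2) := Real.rpow_pos_of_pos hx' _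
        have h6 := mul_pos h5 (sub_pos.mpr h4)
        nlinarith [h6]
    have h7 := hM (Set.mem_Ioi.mpr ht) (Set.mem_Ioi.mpr ht') htt'
    simp only at h7
    rw [Real.rpow_neg ht.le, Real.rpow_neg ht'.le] at h7
    rw [Real.div_rpow ht'.le ht.le]
    have p1 : 0 < t ^ μ₂ := Real.rpow_pos_of_pos ht _
    have p2 : 0 < t' ^ μ₂ := Real.rpow_pos_of_pos ht' _
    have h8 := mul_le_mul_of_nonneg_right h7 p2.le
    calc t' ^ μ₂ / t ^ μ₂ * (deriv f (t * s) * s)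
        = deriv f (t * s) * s * (t ^ μ₂)⁻¹ * t' ^ μ₂ := by ring
      _ ≤ _ := h8
      _ = _ := by field_simp
  have hmono1 : ∀ s t t' : ℝ, 0 < t → t ≤ t' →
      (deriv f (t * s) * s) ≤ deriv f (t' * s) * s := by
    intro s t t' ht htt'
    refine le_trans ?_ (hmono s t t' ht htt')
    have : 1 ≤ (t' / t) ^ μ₂ :=
      Real.one_le_rpow ((one_le_div ht).mpr htt') (by linarith)
    nlinarith [hnn t s ht]
  -- growth
  have hgr : ∀ s : ℝ, s ≠ 0 → s * deriv f s ≤ s ^ 2 * |deriv (deriv f) s| := by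
    intro s hs
    have h1 := hfμ2 s hs
    have h2 := hsf s
    have h3 : s ^ 2 * deriv (deriv f) s ≤ s ^ 2 * |deriv (deriv f) s| :=
      mul_le_mul_of_nonneg_left (le_abs_self _) (sq_nonneg s)
    nlinarith
  have hpow : ∀ (s r : ℝ), s ≠ 0 → s ^ 2 * (c₂ * |s| ^ (r - 2)) = c₂ * |s| ^ r := by
    intro s r hs
    have : |s| ^ r = |s| ^ (r - 2) * |s| ^ 2 := by
      rw [← Real.rpow_natCast, ← Real.rpow_add (abs_pos.mpr hs)]; congr 1; push_cast; ring
    rw [this, sq_abs]; ring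
  have hg1 : ∀ s : ℝ, s ≠ 0 → 1 ≤ |s| → s * deriv f s ≤ c₂ * |s| ^ p := by
    intro s hs h1
    rw [← hpow s p hs]
    exact (hgr s hs).trans (mul_le_mul_of_nonneg_left (hf2_1 s h1) (sq_nonneg s))
  have hg2 : ∀ s : ℝ, s ≠ 0 → |s| ≤ 1 → s * deriv f s ≤ c₂ * |s| ^ q := by
    intro s hs h1
    rw [← hpow s q hs]
    exact (hgr s hs).trans
      (mul_le_mul_of_nonneg_left (hf2_2 s (abs_pos.mpr hs) h1) (sq_nonneg s))
  have hgp : ∀ s : ℝ, s ≠ 0 → s * deriv f s ≤ c₂ * |s| ^ p := by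
    intro s hs
    rcases le_total 1 |s| with h | h
    · exact hg1 s hs h
    · exact (hg2 s hs h).trans (mul_le_mul_of_nonneg_left
        (Real.rpow_le_rpow_of_exponent_ge (abs_pos.mpr hs) h hpq.le) hc₂.le)
  have hgq : ∀ s : ℝ, s ≠ 0 → s * deriv f s ≤ c₂ * |s| ^ q := by
    intro s hs
    rcases le_total 1 |s| with h | h
    · exact (hg1 s hs h).trans (mul_le_mul_of_nonneg_left
        (Real.rpow_le_rpow_of_exponent_le h hpq.le) hc₂.le)
    · exact hg2 s hs h
  have hbd : ∀ t r : ℝ, 0 < t → (∀ s : ℝ, s ≠ 0 → s * deriv f s ≤ c₂ * |s| ^ r) →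
      ∀ s : ℝ, ‖deriv f (t * s) * s‖ ≤ (c₂ * t ^ r / t) * |s| ^ r := by
    intro t r ht H s
    rw [Real.norm_of_nonneg (hnn t s ht)]
    rcases eq_or_ne s 0 with h | h
    · subst h
      simp only [mul_zero]
      positivity
    have h1 := H (t * s) (mul_ne_zero ht.ne' h)
    rw [abs_mul, abs_of_pos ht, Real.mul_rpow ht.le (abs_nonneg s)] at h1
    rw [div_mul_eq_mul_div, le_div_iff₀ ht]
    linarith
  have hmeas : ∀ t : ℝ, Measurable (fun x => deriv f (t * u x) * u x) := by
    intro t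
    exact (hcd.measurable.comp (hu_meas.const_mul t)).mul hu_meas
  have hint : ∀ t : ℝ, 0 < t → Integrable (fun x => deriv f (t * u x) * u x) := by
    intro t ht
    have i1 : IntegrableOn (fun x => deriv f (t * u x) * u x) {x | 1 ≤ |u x|} :=
      Integrable.mono' (hu_p.const_mul (c₂ * t ^ p / t)) (hmeas t).aestronglyMeasurable
        (Eventually.of_forall fun x => hbd t p ht hgp (u x))
    have i2 : IntegrableOn (fun x => deriv f (t * u x) * u x) {x | |u x| < 1} :=
      Integrable.mono' (hu_q.const_mul (c₂ * t ^ q / t)) (hmeas t).aestronglyMeasurable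
        (Eventually.of_forall fun x => hbd t q ht hgq (u x))
    have i3 := i1.union i2
    have : {x | 1 ≤ |u x|} ∪ {x | |u x| < 1} = Set.univ := by
      ext x; simp [le_or_gt]
    rw [this, integrableOn_univ] at i3
    exact i3
  obtain ⟨I, hI⟩ : ∃ I : ℝ → ℝ, I = fun t => ∫ x, deriv f (t * u x) * u x := ⟨_, rfl⟩
  have hIe : ∀ t, (∫ x, deriv f (t * u x) * u x) = I t := by intro t; rw [hI]
  have hI0 : ∀ t, 0 < t → 0 ≤ I t := by
    intro t ht
    rw [← hIe]
    exact integral_nonneg fun x => hnn t (u x) ht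
  have hIm : ∀ t t' : ℝ, 0 < t → t ≤ t' → (t' / t) ^ μ₂ * I t ≤ I t' := by
    intro t t' ht htt'
    rw [← hIe, ← hIe, ← integral_const_mul]
    exact integral_mono ((hint t ht).const_mul _) (hint t' (ht.trans_le htt'))
      fun x => hmono (u x) t t' ht htt'
  have hIm1 : ∀ t t' : ℝ, 0 < t → t ≤ t' → (t' / t) * I t ≤ I t' := by
    intro t t' ht htt'
    refine le_trans ?_ (hIm t t' ht htt')
    apply mul_le_mul_of_nonneg_right _ (hI0 t ht)
    exact Real.self_le_rpow_of_one_le ((one_le_div ht).mpr htt') hμ₂.le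
  have hIc : ∀ T : ℝ, 0 < T → ContinuousOn I (Set.Ioc 0 T) := by
    intro T hT
    rw [hI]
    apply continuousOn_of_dominated (bound := fun x => deriv f (T * u x) * u x)
    · intro t _
      exact (hmeas t).aestronglyMeasurable
    · intro t ht
      refine Eventually.of_forall fun x => ?_
      rw [Real.norm_of_nonneg (hnn t (u x) ht.1)]
      exact hmono1 (u x) t T ht.1 ht.2
    · exact hint T hT
    · refine Eventually.of_forall fun x => ?_
      exact ((hcd.comp (continuous_id.mul continuous_const)).mul continuous_const).continuousOn
  simp only [hIe] at ht0eq ⊢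
  have hgt : ∀ t1 : ℝ, 0 < t1 → t1 * A = I t1 + G → t0 < t1 := by
    intro t1 h1 he
    by_contra hle
    push Not at hle
    have h2 := hIm1 t1 t0 h1 hle
    rw [div_mul_eq_mul_div, div_le_iff₀ h1] at h2
    have h3 : I t1 = t1 * A - G := by linarith
    rw [h3, ← ht0eq] at h2
    nlinarith
  have huniq : ∀ t t' : ℝ, 0 < t → t < t' → t * A = I t + G → t' * A = I t' + G → False := by
    intro t t' ht htt' h h'
    have h2 := hIm1 t t' ht htt'.le
    rw [div_mul_eq_mul_div, div_le_iff₀ ht] at h2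
    have h3 : I t = t * A - G := by linarith
    have h4 : I t' = t' * A - G := by linarith
    rw [h3, h4] at h2
    nlinarith
  refine ⟨?_, hgt⟩
  obtain ⟨r, hr1, hr2⟩ : ∃ r : ℝ, 1 ≤ r ∧ 1 + (-G) / (t0 * A) ≤ r ^ (μ₂ - 1) :=
    ((eventually_ge_atTop 1).and ((tendsto_rpow_atTop (sub_pos.mpr hμ₂)).eventually_ge_atTop
      (1 + (-G) / (t0 * A)))).exists
  have hr0 : 0 < r := by linarith
  have htA : 0 < t0 * A := mul_pos ht0 hA
  have hT : t0 ≤ t0 * r := le_mul_of_one_le_right ht0.le hr1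
  have hfin : -G ≤ I (t0 * r) - t0 * r * A := by
    have h1 := hIm t0 (t0 * r) ht0 hT
    rw [mul_div_cancel_left₀ _ ht0.ne', ← ht0eq] at h1
    have h2 : r ^ μ₂ = r ^ (μ₂ - 1) * r := by
      nth_rewrite 3 [← Real.rpow_one r]
      rw [← Real.rpow_add hr0]; congr 1; ring
    rw [h2] at h1
    have h3 := mul_le_mul_of_nonneg_right hr2 htA.le
    rw [add_mul, div_mul_cancel₀ _ htA.ne'] at h3
    have h4 := mul_le_mul_of_nonneg_right h3 hr0.le
    nlinarith
  have hc : ContinuousOn (fun t => I t - t * A) (Set.Icc t0 (t0 * r)) :=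
    ((hIc (t0 * r) (mul_pos ht0 hr0)).mono
      (fun x hx => ⟨ht0.trans_le hx.1, hx.2⟩)).sub (continuous_id.mul continuous_const).continuousOn
  obtain ⟨t1, ht1, he⟩ := intermediate_value_Icc hT hc
    (show -G ∈ Set.Icc (I t0 - t0 * A) (I (t0 * r) - t0 * r * A) from ⟨by linarith, hfin⟩)
  simp only at he
  have ht1p : 0 < t1 := ht0.trans_le ht1.1
  have he' : t1 * A = I t1 + G := by linarith
  refine ⟨t1, ⟨ht1p, he'⟩, ?_⟩
  rintro y ⟨hy, hye⟩
  rcases lt_trichotomy y t1 with h | h | h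
  · exact (huniq y t1 hy h hye he').elim
  · exact h
  · exact (huniq t1 y ht1p h he' hye).elim
end

section
/- Let A > 0, let T > 0 be the unique positive number with ∫_{ℝ^N} f''(T·u)·u² dx = A, and let t⁰ > 0 be the unique positive number with t⁰·A = ∫_{ℝ^N} f'(t⁰·u)·u dx. If G is a real number with 0 < G < T·A − ∫_{ℝ^N} f'(T·u)·u dx, then there exist exactly two positive numbers t satisfying t·A = ∫_{ℝ^N} f'(t·u)·u dx + G; calling them t² < t¹, they satisfy t² < T < t¹ < t⁰. (This is case 3 of Proposition 2.8 on the structure of the Nehari manifold, with G = ∫gu > 0 small.) -/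
open Real MeasureTheory Filter

theorem stmt12 (N : ℕ) (hN : 0 < N)
    (f : ℝ → ℝ) (p q c₀ c₂ μ₁ μ₂ : ℝ)
    (hf_even : ∀ s : ℝ, f (-s) = f s) (hf_C1 : ContDiff ℝ 1 f)
    (hf0 : f 0 = 0) (hf'0 : deriv f 0 = 0)
    (hf_diff2 : ∀ s : ℝ, s ≠ 0 → DifferentiableAt ℝ (deriv f) s)
    (hf_diff3 : ∀ s : ℝ, s ≠ 0 → DifferentiableAt ℝ (deriv (deriv f)) s)
    (hc₀ : 0 < c₀) (hc₂ : 0 < c₂) (hp : 2 < p) (hpq : p < q)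
    (hμ₁ : 2 < μ₁) (hμ₂ : 1 < μ₂)
    (hf_low1 : ∀ s : ℝ, 1 ≤ |s| → c₀ * |s| ^ p ≤ f s)
    (hf_low2 : ∀ s : ℝ, |s| ≤ 1 → c₀ * |s| ^ q ≤ f s)
    (hf2_1 : ∀ s : ℝ, 1 ≤ |s| → |deriv (deriv f) s| ≤ c₂ * |s| ^ (p - 2))
    (hf2_2 : ∀ s : ℝ, 0 < |s| → |s| ≤ 1 → |deriv (deriv f) s| ≤ c₂ * |s| ^ (q - 2))
    (hfμ1 : ∀ s : ℝ, s ≠ 0 → 0 < μ₁ * f s ∧ μ₁ * f s ≤ s * deriv f s)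
    (hfμ2 : ∀ s : ℝ, s ≠ 0 → μ₂ * (s * deriv f s) < s ^ 2 * deriv (deriv f) s)
    (hfμ3 : ∀ s : ℝ, s ≠ 0 → 0 < s ^ 3 * deriv (deriv (deriv f)) s)
    (u : EuclideanSpace ℝ (Fin N) → ℝ) (hu_meas : Measurable u)
    (hu_pos : 0 < volume {x | u x ≠ 0})
    (hu_p : IntegrableOn (fun x => |u x| ^ p) {x | 1 ≤ |u x|})
    (hu_q : IntegrableOn (fun x => |u x| ^ q) {x | |u x| < 1})
    (A : ℝ) (hA : 0 < A)
    (T : ℝ) (hT : 0 < T) (hTeq : ∫ x, deriv (deriv f) (T * u x) * (u x) ^ 2 = A)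
    (t0 : ℝ) (ht0 : 0 < t0) (ht0eq : t0 * A = ∫ x, deriv f (t0 * u x) * u x)
    (G : ℝ) (hG : 0 < G) (hGsmall : G < T * A - ∫ x, deriv f (T * u x) * u x) :
    ∃ t1 t2 : ℝ, 0 < t2 ∧ t2 < T ∧ T < t1 ∧ t1 < t0 ∧
      t1 * A = (∫ x, deriv f (t1 * u x) * u x) + G ∧
      t2 * A = (∫ x, deriv f (t2 * u x) * u x) + G ∧
      ∀ t : ℝ, 0 < t → t * A = (∫ x, deriv f (t * u x) * u x) + G →
        t = t1 ∨ t = t2 := by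
  have hcont : Continuous (deriv f) := hf_C1.continuous_deriv le_rfl
  have hodd : ∀ s, deriv f (-s) = - deriv f s := by
    intro s
    have h1 : f = fun x => f (-x) := by funext x; rw [hf_even]
    have h2 := deriv_comp_neg (f := f) (x := s)
    have h3 : deriv f s = deriv (fun x => f (-x)) s := congrArg (fun g => deriv g s) h1
    rw [h2] at h3
    linarith
  have habs : ∀ t v : ℝ, deriv f (t * v) * v = deriv f (t * |v|) * |v| := by
    intro t v
    rcases abs_cases v with ⟨h, _⟩ | ⟨h, _⟩
    · rw [h]
    · rw [h, mul_neg t, hodd]; ring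
  have hmono : StrictMonoOn (deriv (deriv f)) (Set.Ioi 0) := by
    apply strictMonoOn_of_deriv_pos (convex_Ioi 0)
    · intro s hs
      exact (hf_diff3 s (ne_of_gt hs)).continuousAt.continuousWithinAt
    · intro s hs
      rw [interior_Ioi] at hs
      have hs' : 0 < s := hs
      exact pos_of_mul_pos_right (hfμ3 s hs'.ne') (by positivity)
  have hconv : StrictConvexOn ℝ (Set.Ici 0) (deriv f) := by
    apply StrictMonoOn.strictConvexOn_of_deriv (convex_Ici 0) hcont.continuousOn
    rw [interior_Ici]; exact hmono
  have hpos : ∀ s : ℝ, 0 ≤ s * deriv f s := by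
    intro s
    by_cases h : s = 0
    · simp [h]
    · linarith [(hfμ1 s h).1, (hfμ1 s h).2]
  have hb : ∀ s : ℝ, s ≠ 0 → s * deriv f s ≤ s ^ 2 * |deriv (deriv f) s| := by
    intro s h
    have h1 := hfμ2 s h
    have h2 := mul_le_mul_of_nonneg_left (le_abs_self (deriv (deriv f) s)) (sq_nonneg s)
    nlinarith [hpos s]
  have hpw : ∀ s r : ℝ, s ≠ 0 → s ^ 2 * (c₂ * |s| ^ (r - 2)) = c₂ * |s| ^ r := by
    intro s r h
    have h0 : 0 < |s| := abs_pos.mpr h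
    have : |s| ^ r = |s| ^ (2:ℕ) * |s| ^ (r - 2) := by
      rw [← Real.rpow_natCast, ← Real.rpow_add h0]; congr 1; push_cast; ring
    rw [this, sq_abs]; ring
  have hbp : ∀ s : ℝ, s * deriv f s ≤ c₂ * |s| ^ p ∧ s * deriv f s ≤ c₂ * |s| ^ q := by
    intro s
    by_cases h : s = 0
    · subst h
      constructor <;> · simp only [zero_mul]; positivity
    have h0 : 0 < |s| := abs_pos.mpr h
    have h1 := hb s h
    rcases le_total 1 |s| with hs | hs
    · have h2 := mul_le_mul_of_nonneg_left (hf2_1 s hs) (sq_nonneg s)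
      rw [hpw s p h] at h2
      have h3 := mul_le_mul_of_nonneg_left
        (Real.rpow_le_rpow_of_exponent_le hs hpq.le) hc₂.le
      constructor <;> linarith
    · have h2 := mul_le_mul_of_nonneg_left (hf2_2 s h0 hs) (sq_nonneg s)
      rw [hpw s q h] at h2
      have h3 := mul_le_mul_of_nonneg_left
        (Real.rpow_le_rpow_of_exponent_ge h0 hs hpq.le) hc₂.le
      constructor <;> linarith
  have hmeas : ∀ t : ℝ, Measurable (fun x => deriv f (t * u x) * u x) := by
    intro t
    exact (hcont.measurable.comp (hu_meas.const_mul t)).mul hu_meas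
  have hnn : ∀ t : ℝ, 0 < t → ∀ v, 0 ≤ deriv f (t * v) * v := by
    intro t ht v
    have h := hpos (t * v)
    have : 0 ≤ t * (deriv f (t * v) * v) := by linarith
    exact nonneg_of_mul_nonneg_right this ht
  have hbd : ∀ r : ℝ, (∀ s : ℝ, s * deriv f s ≤ c₂ * |s| ^ r) → ∀ t : ℝ, 0 < t → ∀ v,
      ‖deriv f (t * v) * v‖ ≤ (c₂ * t ^ r / t) * |v| ^ r := by
    intro r hr t ht v
    rw [Real.norm_of_nonneg (hnn t ht v)]
    have h := hr (t * v)
    rw [abs_mul, abs_of_pos ht, Real.mul_rpow ht.le (abs_nonneg v)] at h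
    rw [div_mul_eq_mul_div, le_div_iff₀ ht]
    linarith
  have hint : ∀ t : ℝ, 0 ≤ t → Integrable (fun x => deriv f (t * u x) * u x) := by
    intro t ht
    rcases ht.eq_or_lt with rfl | ht
    · simp [hf'0]
    rw [← integrableOn_univ]
    have hun : (Set.univ : Set (EuclideanSpace ℝ (Fin N))) =
        {x | 1 ≤ |u x|} ∪ {x | |u x| < 1} := by
      ext x; simpa using le_or_gt 1 |u x|
    rw [hun]
    refine IntegrableOn.union ?_ ?_
    · exact (hu_p.const_mul (c₂ * t ^ p / t)).mono' (hmeas t).aestronglyMeasurable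
        (Eventually.of_forall fun x => hbd p (fun s => (hbp s).1) t ht (u x))
    · exact (hu_q.const_mul (c₂ * t ^ q / t)).mono' (hmeas t).aestronglyMeasurable
        (Eventually.of_forall fun x => hbd q (fun s => (hbp s).2) t ht (u x))
  have hIconv : StrictConvexOn ℝ (Set.Ici 0) (fun t : ℝ => ∫ x, deriv f (t * u x) * u x) := by
    refine ⟨convex_Ici 0, ?_⟩
    intro x hx y hy hxy a b ha hb' hab
    have hx' : 0 ≤ x := hx
    have hy' : 0 ≤ y := hy
    simp only [smul_eq_mul]
    rw [← integral_const_mul, ← integral_const_mul,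
      ← integral_add ((hint x hx).const_mul a) ((hint y hy).const_mul b)]
    have hlt : ∀ z, u z ≠ 0 → deriv f ((a * x + b * y) * u z) * u z <
        a * (deriv f (x * u z) * u z) + b * (deriv f (y * u z) * u z) := by
      intro z hz
      have hz' : 0 < |u z| := abs_pos.mpr hz
      rw [habs, habs x, habs y]
      have h := hconv.2 (x := x * |u z|) (by simp only [Set.mem_Ici]; positivity)
        (y := y * |u z|) (by simp only [Set.mem_Ici]; positivity)
        (fun h => hxy (mul_right_cancel₀ hz'.ne' h)) ha hb' hab
      simp only [smul_eq_mul] at h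
      have h2 := mul_lt_mul_of_pos_right h hz'
      have e : (a * x + b * y) * |u z| = a * (x * |u z|) + b * (y * |u z|) := by ring
      rw [e]
      linarith
    have hi1 := hint (a * x + b * y) (by positivity)
    have hi2 : Integrable (fun z => a * (deriv f (x * u z) * u z) +
        b * (deriv f (y * u z) * u z)) := ((hint x hx).const_mul a).add ((hint y hy).const_mul b)
    rw [← sub_pos, ← integral_sub hi2 hi1]
    refine (integral_pos_iff_support_of_nonneg ?_ (hi2.sub hi1)).mpr ?_
    rotate_left
    · refine lt_of_lt_of_le hu_pos (measure_mono ?_)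
      intro z hz
      exact (sub_pos.mpr (hlt z hz)).ne'
    · intro z
      by_cases hz : u z = 0
      · simp [hz]
      · exact (sub_pos.mpr (hlt z hz)).le
  set I : ℝ → ℝ := fun t => ∫ x, deriv f (t * u x) * u x with hI
  have hI0 : I 0 = 0 := by simp [hI, hf'0]
  have hInn : ∀ t, 0 < t → 0 ≤ I t := fun t ht => integral_nonneg fun x => hnn t ht (u x)
  have hIT : G < T * A - I T := hGsmall
  have hIt0 : t0 * A = I t0 := ht0eq
  -- three-point property
  have h3 : ∀ a b c : ℝ, 0 ≤ a → a < b → b < c →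
      min (a * A - I a) (c * A - I c) < b * A - I b := by
    intro a b c ha hab hbc
    have hca : 0 < c - a := by linarith
    have h := hIconv.2 (show a ∈ Set.Ici (0:ℝ) from ha)
      (show c ∈ Set.Ici (0:ℝ) by simp only [Set.mem_Ici]; linarith)
      (by linarith : a < c).ne
      (show 0 < (c - b) / (c - a) from div_pos (by linarith) hca)
      (show 0 < (b - a) / (c - a) from div_pos (by linarith) hca) (by field_simp; ring)
    simp only [smul_eq_mul] at h
    have e : (c - b) / (c - a) * a + (b - a) / (c - a) * c = b := by field_simp; ring
    rw [e] at h
    have h' : (c - a) * I b < (c - b) * I a + (b - a) * I c := by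
      have := mul_lt_mul_of_pos_left h hca
      have e2 : (c - a) * ((c - b) / (c - a) * I a + (b - a) / (c - a) * I c) =
        (c - b) * I a + (b - a) * I c := by field_simp
      linarith
    by_contra hcon
    push Not at hcon
    obtain ⟨h1, h2⟩ := le_min_iff.mp hcon
    nlinarith [mul_le_mul_of_nonneg_left h1 (by linarith : (0:ℝ) ≤ c - b),
      mul_le_mul_of_nonneg_left h2 (by linarith : (0:ℝ) ≤ b - a)]
  have hIc : ContinuousOn I (Set.Ioi 0) :=
    (hIconv.convexOn.subset Set.Ioi_subset_Ici_self (convex_Ioi 0)).continuousOn isOpen_Ioi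
  have hφc : ContinuousOn (fun t => t * A - I t) (Set.Ioi 0) :=
    (continuous_id.mul continuous_const).continuousOn.sub hIc
  have hTt0 : T < t0 := by
    by_contra hcon
    rcases (not_lt.mp hcon).eq_or_lt with h | h
    · rw [h] at hIt0; linarith
    · have h' := h3 0 t0 T le_rfl ht0 h
      rw [hI0, min_eq_left (by linarith)] at h'
      linarith
  obtain ⟨e, he0, heT, heG⟩ : ∃ e : ℝ, 0 < e ∧ e < T ∧ e * A < G := by
    refine ⟨min (T / 2) (G / A / 2), by positivity, ?_, ?_⟩
    · exact (min_le_left _ _).trans_lt (by linarith)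
    · have h : min (T / 2) (G / A / 2) * A ≤ G / A / 2 * A :=
        mul_le_mul_of_nonneg_right (min_le_right _ _) hA.le
      have e2 : G / A / 2 * A = G / 2 := by field_simp
      linarith
  obtain ⟨t2, ⟨h2a, h2b⟩, h2⟩ := intermediate_value_Ioo heT.le
    (hφc.mono fun z hz => lt_of_lt_of_le he0 hz.1)
    (show G ∈ Set.Ioo (e * A - I e) (T * A - I T) from ⟨by linarith [hInn e he0], hIT⟩)
  obtain ⟨t1, ⟨h1a, h1b⟩, h1⟩ := intermediate_value_Ioo' hTt0.le
    (hφc.mono fun z hz => lt_of_lt_of_le hT hz.1)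
    (show G ∈ Set.Ioo (t0 * A - I t0) (T * A - I T) from ⟨by linarith, hIT⟩)
  simp only at h1 h2
  refine ⟨t1, t2, by linarith, h2b, h1a, h1b, ?_, ?_, ?_⟩
  · change t1 * A = I t1 + G
    linarith
  · change t2 * A = I t2 + G
    linarith
  · intro t ht hte
    have hte' : t * A - I t = G := by
      have : t * A = I t + G := hte
      linarith
    by_contra hne
    push Not at hne
    rcases lt_or_gt_of_ne hne.2 with h | h
    · have := h3 t t2 t1 ht.le h (by linarith)
      rw [h1, h2, hte', min_self] at this
      exact lt_irrefl _ this
    rcases lt_or_gt_of_ne hne.1 with h' | h'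
    · have := h3 t2 t t1 (by linarith) h h'
      rw [h1, h2, hte', min_self] at this
      exact lt_irrefl _ this
    · have := h3 t2 t1 t (by linarith) (by linarith) h'
      rw [h1, h2, hte', min_self] at this
      exact lt_irrefl _ this
end

section
/- There exists L > 0 such that for every compactly supported C¹ function u : ℝ^N → ℝ with ‖u‖_V = 1 and every T > 0 with ∫_{ℝ^N} f''(T·u(x))·u(x)² dx = 1 (i.e. T·u belongs to 𝒱 = {w ≠ 0 : ‖w‖_V² = ∫ f''(w)w² dx}), one has T − ∫_{ℝ^N} f'(T·u(x))·u(x) dx ≥ L. (Lemma 2.7: L = inf_{‖u‖_V = 1} T_u − ∫ f'(T_u u)u > 0.) -/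
open Real MeasureTheory Filter

lemma sobolev_real (N : ℕ) (hN : 3 ≤ N) (r : ℝ) (hr : r = 2 * N / (N - 2 : ℝ)) :
    ∃ C : ℝ, 0 ≤ C ∧ ∀ u : EuclideanSpace ℝ (Fin N) → ℝ, ContDiff ℝ 1 u →
      HasCompactSupport u →
      (∫ x, ‖u x‖ ^ r) ≤ C * (∫ x, ‖fderiv ℝ u x‖ ^ 2) ^ (r / 2) := by
  have hN' : (3 : ℝ) ≤ N := by exact_mod_cast hN
  have hr0 : 0 < r := by rw [hr]; apply div_pos <;> linarith
  obtain ⟨ρ, hρ⟩ : ∃ ρ : NNReal, (ρ : ℝ) = r := ⟨r.toNNReal, Real.coe_toNNReal r hr0.le⟩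
  obtain ⟨K, hKd⟩ : ∃ K : NNReal, K = SNormLESNormFDerivOfEqConst ℝ
    (volume : Measure (EuclideanSpace ℝ (Fin N))) ((2 : NNReal) : ℝ) := ⟨_, rfl⟩
  have hK : 0 ≤ (K : ℝ) := NNReal.coe_nonneg _
  refine ⟨(K : ℝ) ^ r, by positivity, fun u hu hc => ?_⟩
  have h := eLpNorm_le_eLpNorm_fderiv_of_eq (volume : Measure (EuclideanSpace ℝ (Fin N)))
    hu hc (p := 2) (p' := ρ) (by norm_num) (by simp; omega) (by
      simp only [finrank_euclideanSpace, Fintype.card_fin, hρ, hr]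
      have : (N : ℝ) - 2 ≠ 0 := by linarith
      push_cast
      field_simp)
  rw [← hKd] at h
  have m1 : MemLp u (ρ : ENNReal) volume :=
    hu.continuous.memLp_of_hasCompactSupport hc
  have m2 : MemLp (fderiv ℝ u) ((2 : NNReal) : ENNReal) volume :=
    (hu.continuous_fderiv one_ne_zero).memLp_of_hasCompactSupport (hc.fderiv ℝ)
  have hne : (ρ : ENNReal) ≠ 0 := by
    rw [ENNReal.coe_ne_zero]
    intro h0
    rw [h0] at hρ
    exact hr0.ne hρ
  rw [m1.eLpNorm_eq_integral_rpow_norm hne ENNReal.coe_ne_top,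
    m2.eLpNorm_eq_integral_rpow_norm (by norm_num) ENNReal.coe_ne_top,
    ← ENNReal.ofReal_coe_nnreal (p := K), ← ENNReal.ofReal_mul (NNReal.coe_nonneg _)] at h
  simp only [ENNReal.coe_toReal, hρ] at h
  set A := ∫ x, ‖u x‖ ^ r with hA
  have hA0 : 0 ≤ A := integral_nonneg fun x => by positivity
  have e2 : (∫ x, ‖fderiv ℝ u x‖ ^ (((2 : NNReal)) : ℝ)) = ∫ x, ‖fderiv ℝ u x‖ ^ 2 := by
    congr 1; ext x; norm_num
  rw [e2] at h
  set B := ∫ x, ‖fderiv ℝ u x‖ ^ 2 with hB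
  have hB0 : 0 ≤ B := integral_nonneg fun x => by positivity
  have h' : A ^ r⁻¹ ≤ K * B ^ ((2 : ℝ)⁻¹) := by
    have := (ENNReal.ofReal_le_ofReal_iff (by positivity)).1 h
    simpa using this
  have h2 := Real.rpow_le_rpow (by positivity) h' hr0.le
  rw [Real.rpow_inv_rpow hA0 hr0.ne', Real.mul_rpow hK (by positivity),
    ← Real.rpow_mul hB0] at h2
  convert h2 using 3
  ring

theorem stmt14 (N : ℕ) (hN : 3 ≤ N)
    (f : ℝ → ℝ) (p q c₀ c₂ μ₁ μ₂ : ℝ)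
    (hf_even : ∀ s : ℝ, f (-s) = f s) (hf_C1 : ContDiff ℝ 1 f)
    (hf0 : f 0 = 0) (hf'0 : deriv f 0 = 0)
    (hf_diff2 : ∀ s : ℝ, s ≠ 0 → DifferentiableAt ℝ (deriv f) s)
    (hf_diff3 : ∀ s : ℝ, s ≠ 0 → DifferentiableAt ℝ (deriv (deriv f)) s)
    (hc₀ : 0 < c₀) (hc₂ : 0 < c₂) (hp : 2 < p)
    (hp2 : p < 2 * N / (N - 2 : ℝ)) (hq : 2 * N / (N - 2 : ℝ) < q)
    (hμ₁ : 2 < μ₁) (hμ₂ : 1 < μ₂)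
    (hf_low1 : ∀ s : ℝ, 1 ≤ |s| → c₀ * |s| ^ p ≤ f s)
    (hf_low2 : ∀ s : ℝ, |s| ≤ 1 → c₀ * |s| ^ q ≤ f s)
    (hf2_1 : ∀ s : ℝ, 1 ≤ |s| → |deriv (deriv f) s| ≤ c₂ * |s| ^ (p - 2))
    (hf2_2 : ∀ s : ℝ, 0 < |s| → |s| ≤ 1 → |deriv (deriv f) s| ≤ c₂ * |s| ^ (q - 2))
    (hfμ1 : ∀ s : ℝ, s ≠ 0 → 0 < μ₁ * f s ∧ μ₁ * f s ≤ s * deriv f s)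
    (hfμ2 : ∀ s : ℝ, s ≠ 0 → μ₂ * (s * deriv f s) < s ^ 2 * deriv (deriv f) s)
    (hfμ3 : ∀ s : ℝ, s ≠ 0 → 0 < s ^ 3 * deriv (deriv (deriv f)) s)
    (V : EuclideanSpace ℝ (Fin N) → ℝ) (hV_meas : Measurable V)
    (hV_loc : LocallyIntegrable V) (hV_nonpos : ∀ᵐ x, V x ≤ 0)
    (θ : ℝ) (hθ0 : 0 < θ) (hθ1 : θ ≤ 1)
    (hcoerc : ∀ w : EuclideanSpace ℝ (Fin N) → ℝ, ContDiff ℝ 1 w →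
      HasCompactSupport w →
      θ * (∫ x, ‖fderiv ℝ w x‖ ^ 2) ≤
        ∫ x, (‖fderiv ℝ w x‖ ^ 2 + V x * w x ^ 2))
    :
    ∃ L : ℝ, 0 < L ∧
      ∀ u : EuclideanSpace ℝ (Fin N) → ℝ, ContDiff ℝ 1 u → HasCompactSupport u →
        (∫ x, (‖fderiv ℝ u x‖ ^ 2 + V x * u x ^ 2)) = 1 →
        ∀ T : ℝ, 0 < T →
          (∫ x, deriv (deriv f) (T * u x) * u x ^ 2) = 1 →
          L ≤ T - ∫ x, deriv f (T * u x) * u x := by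
  obtain ⟨r, hr⟩ : ∃ r : ℝ, r = 2 * N / (N - 2 : ℝ) := ⟨_, rfl⟩
  obtain ⟨C, hC, hS⟩ := sobolev_real N hN r hr
  rw [← hr] at hp2 hq
  have hr2 : 2 < r := hp.trans hp2
  have hbd : ∀ s : ℝ, s ≠ 0 → deriv (deriv f) s ≤ c₂ * |s| ^ (r - 2) := by
    intro s hs
    have hs' : 0 < |s| := abs_pos.2 hs
    refine (le_abs_self _).trans ?_
    rcases le_total 1 |s| with h | h
    · refine (hf2_1 s h).trans ?_
      gcongr
    · refine (hf2_2 s hs' h).trans ?_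
      have := Real.rpow_le_rpow_of_exponent_ge hs' h (show r - 2 ≤ q - 2 by linarith)
      gcongr
  obtain ⟨D, hD⟩ : ∃ D : ℝ, D = c₂ * C * (1 / θ) ^ (r / 2) + 1 := ⟨_, rfl⟩
  have hD0 : 0 < D := by rw [hD]; positivity
  have hμ0 : 0 < 1 - 1 / μ₂ := by
    rw [sub_pos, div_lt_one (by linarith)]; exact hμ₂
  refine ⟨(1 - 1 / μ₂) * (1 / D) ^ ((r - 2)⁻¹), by positivity, ?_⟩
  intro u hu hc hn T hT h1
  have hint : Integrable (fun x => deriv (deriv f) (T * u x) * u x ^ 2) := by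
    by_contra hni
    rw [integral_undef hni] at h1
    norm_num at h1
  -- lower bound on T
  have hB0 : 0 ≤ ∫ x, ‖fderiv ℝ u x‖ ^ 2 := integral_nonneg fun x => by positivity
  have hB : (∫ x, ‖fderiv ℝ u x‖ ^ 2) ≤ 1 / θ := by
    have := hcoerc u hu hc
    rw [hn] at this
    rw [le_div_iff₀ hθ0]; linarith
  have hcontr : Continuous (fun x => ‖u x‖ ^ r) :=
    hu.continuous.norm.rpow_const (fun x => Or.inr (by linarith))
  have hintr : Integrable (fun x => ‖u x‖ ^ r) :=
    hcontr.integrable_of_hasCompactSupport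
      (hc.comp_left (g := fun t : ℝ => ‖t‖ ^ r) (by
        simp only [norm_zero]; exact Real.zero_rpow (by linarith)))
  have hT1 : 1 ≤ c₂ * T ^ (r - 2) * ∫ x, ‖u x‖ ^ r := by
    rw [← h1, ← integral_const_mul]
    refine integral_mono hint (hintr.const_mul _) (fun x => ?_)
    by_cases hx : u x = 0
    · simp only [hx]; norm_num; positivity
    · have hx' : 0 < |u x| := abs_pos.2 hx
      have := hbd (T * u x) (mul_ne_zero hT.ne' hx)
      rw [abs_mul, abs_of_pos hT, Real.mul_rpow hT.le hx'.le] at this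
      have e : ‖u x‖ ^ r = |u x| ^ (r - 2) * u x ^ 2 := by
        rw [Real.norm_eq_abs, ← sq_abs (u x), ← Real.rpow_natCast (|u x|) 2,
          ← Real.rpow_add hx']
        norm_num
      calc _ ≤ (c₂ * (T ^ (r - 2) * |u x| ^ (r - 2))) * u x ^ 2 := by
            exact mul_le_mul_of_nonneg_right this (sq_nonneg _)
        _ = _ := by rw [e]; ring
  have hT2 : 1 ≤ D * T ^ (r - 2) := by
    have a1 := hS u hu hc
    have a2 : (∫ x, ‖fderiv ℝ u x‖ ^ 2) ^ (r / 2) ≤ (1 / θ) ^ (r / 2) :=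
      Real.rpow_le_rpow hB0 hB (by linarith)
    have a3 : 0 < T ^ (r - 2) := by positivity
    calc 1 ≤ c₂ * T ^ (r - 2) * ∫ x, ‖u x‖ ^ r := hT1
      _ ≤ c₂ * T ^ (r - 2) * (C * (1 / θ) ^ (r / 2)) := by
          apply mul_le_mul_of_nonneg_left _ (by positivity)
          exact a1.trans (mul_le_mul_of_nonneg_left a2 hC)
      _ = (c₂ * C * (1 / θ) ^ (r / 2)) * T ^ (r - 2) := by ring
      _ ≤ D * T ^ (r - 2) := by
          apply mul_le_mul_of_nonneg_right _ a3.le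
          rw [hD]; linarith
  have hT3 : (1 / D) ^ ((r - 2)⁻¹) ≤ T := by
    have : 1 / D ≤ T ^ (r - 2) := by rw [div_le_iff₀ hD0]; linarith
    have := Real.rpow_le_rpow (by positivity) this
      (show 0 ≤ (r - 2)⁻¹ from inv_nonneg.2 (by linarith))
    rwa [Real.rpow_rpow_inv hT.le (by linarith)] at this
  -- upper bound on the integral
  have hcf : Continuous (deriv f) := hf_C1.continuous_deriv le_rfl
  have hint' : Integrable (fun x => deriv f (T * u x) * u x) := by
    apply Continuous.integrable_of_hasCompactSupport
    · exact (hcf.comp (continuous_const.mul hu.continuous)).mul hu.continuous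
    · exact hc.mul_left
  have hI : (∫ x, deriv f (T * u x) * u x) ≤ T / μ₂ := by
    have : (∫ x, deriv f (T * u x) * u x) ≤
        ∫ x, (T / μ₂) * (deriv (deriv f) (T * u x) * u x ^ 2) := by
      refine integral_mono hint' (hint.const_mul _) (fun x => ?_)
      by_cases hx : u x = 0
      · simp [hx]
      · have := hfμ2 (T * u x) (mul_ne_zero hT.ne' hx)
        have h3 : T * (μ₂ * (deriv f (T * u x) * u x)) ≤
            T * (T * (deriv (deriv f) (T * u x) * u x ^ 2)) := by nlinarith
        have h4 := le_of_mul_le_mul_left h3 hT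
        show deriv f (T * u x) * u x ≤ (T / μ₂) * (deriv (deriv f) (T * u x) * u x ^ 2)
        rw [div_mul_eq_mul_div, le_div_iff₀ (by linarith)]
        linarith
    rwa [integral_const_mul, h1, mul_one] at this
  calc (1 - 1 / μ₂) * (1 / D) ^ ((r - 2)⁻¹) ≤ (1 - 1 / μ₂) * T :=
        mul_le_mul_of_nonneg_left hT3 hμ0.le
    _ = T - T / μ₂ := by ring
    _ ≤ _ := by linarith
end

section
/- Let u₀ : ℝ^N → ℝ be Lebesgue measurable with ∫_{{|u₀| ≥ 1}}|u₀|^p dx < ∞ and ∫_{{|u₀| < 1}}|u₀|^q dx < ∞, and let (ψ_n) be a sequence of measurable functions on ℝ^N with sup_n ∫_{ℝ^N}|ψ_n|^{2*} dx < ∞ and such that, for every R > 0, ∫_{B_R}|ψ_n|^p dx → 0 as n → ∞, where B_R is the closed ball of radius R centered at the origin. Then ∫_{ℝ^N} f(u₀ + ψ_n) dx − ∫_{ℝ^N} f(ψ_n) dx → ∫_{ℝ^N} f(u₀) dx as n → ∞. (This is the Brezis–Lieb-type splitting ∫f(ψ_n) = ∫f(u_n) − ∫f(u₀) + o(1) of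 Lemma 3.2.) -/
open Real MeasureTheory Filter

noncomputable def mmin (a b s : ℝ) : ℝ := min (s ^ a) (s ^ b)

lemma mmin_nonneg (a b s : ℝ) (hs : 0 ≤ s) : 0 ≤ mmin a b s :=
  le_min (rpow_nonneg hs _) (rpow_nonneg hs _)

lemma mmin_mono (a b s t : ℝ) (ha : 0 ≤ a) (hb : 0 ≤ b) (hs : 0 ≤ s) (hst : s ≤ t) :
    mmin a b s ≤ mmin a b t :=
  min_le_min (rpow_le_rpow hs hst ha) (rpow_le_rpow hs hst hb)

lemma mul_mmin (a b s : ℝ) (hs : 0 < s) : s * mmin (a - 1) (b - 1) s = mmin a b s := by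
  unfold mmin
  rw [mul_min_of_nonneg _ _ hs.le, rpow_sub_one hs.ne', rpow_sub_one hs.ne']
  congr 1 <;> field_simp

lemma mmin_one_le (a b s : ℝ) (hab : a ≤ b) (hs : 1 ≤ s) : mmin a b s = s ^ a :=
  min_eq_left (rpow_le_rpow_of_exponent_le hs hab)

lemma mmin_le_one (a b s : ℝ) (hab : a ≤ b) (hs0 : 0 < s) (hs : s ≤ 1) : mmin a b s = s ^ b :=
  min_eq_right (rpow_le_rpow_of_exponent_ge hs0 hs hab)

lemma mmin_scale (a b k s : ℝ) (hab : a ≤ b) (hk : 1 ≤ k) (hs : 0 ≤ s) :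
    mmin a b (k * s) ≤ k ^ b * mmin a b s := by
  unfold mmin
  have hk0 : 0 ≤ k := by linarith
  rw [mul_min_of_nonneg _ _ (rpow_nonneg hk0 _), mul_rpow hk0 hs, mul_rpow hk0 hs]
  refine min_le_min ?_ le_rfl
  exact mul_le_mul_of_nonneg_right (rpow_le_rpow_of_exponent_le hk hab) (rpow_nonneg hs _)

lemma mvt_bound (f : ℝ → ℝ) (p q K : ℝ) (hp : 1 ≤ p) (hq : 1 ≤ q) (hK : 0 ≤ K)
    (hf : Differentiable ℝ f)
    (hd : ∀ s, |deriv f s| ≤ K * mmin (p - 1) (q - 1) |s|) (a b : ℝ) :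
    |f (a + b) - f b| ≤ K * mmin (p - 1) (q - 1) (|a| + |b|) * |a| := by
  have := Convex.norm_image_sub_le_of_norm_deriv_le (f := f) (s := Set.uIcc b (a + b))
    (x := b) (y := a + b) (C := K * mmin (p - 1) (q - 1) (|a| + |b|))
    (fun x _ => hf x) ?_ (convex_uIcc _ _) Set.left_mem_uIcc Set.right_mem_uIcc
  · simpa using this
  · intro x hx
    refine (hd x).trans (mul_le_mul_of_nonneg_left ?_ hK)
    refine mmin_mono _ _ _ _ (by linarith) (by linarith) (abs_nonneg _) ?_
    have h1 : |x - b| ≤ |a + b - b| := by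
      exact Set.abs_sub_left_of_mem_uIcc hx
    have h2 := abs_add_le (x - b) b
    simp at h1 h2
    linarith

lemma upper_bound (f : ℝ → ℝ) (p q K : ℝ) (hp : 1 ≤ p) (hq : 1 ≤ q) (hK : 0 ≤ K)
    (hf : Differentiable ℝ f) (hf0 : f 0 = 0)
    (hd : ∀ s, |deriv f s| ≤ K * mmin (p - 1) (q - 1) |s|) (s : ℝ) :
    |f s| ≤ K * mmin p q |s| := by
  rcases eq_or_ne s 0 with rfl | hs
  · rw [hf0, abs_zero]; exact mul_nonneg hK (mmin_nonneg _ _ _ le_rfl)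
  · have := mvt_bound f p q K hp hq hK hf hd s 0
    rw [← mul_mmin p q |s| (abs_pos.2 hs)]
    simp [hf0] at this
    linarith

lemma key_ineq (f : ℝ → ℝ) (p q K c₀ : ℝ) (hp : 1 ≤ p) (hpq : p ≤ q) (hK : 0 ≤ K)
    (hc₀ : 0 < c₀) (hf : Differentiable ℝ f)
    (hd : ∀ s, |deriv f s| ≤ K * mmin (p - 1) (q - 1) |s|)
    (hlow : ∀ s, c₀ * mmin p q |s| ≤ f s) (ε : ℝ) (hε : 0 < ε) :
    ∃ D, 0 ≤ D ∧ ∀ a b, |f (a + b) - f b| ≤ ε * f b + D * f a := by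
  have hq : 1 ≤ q := hp.trans hpq
  have hfn : ∀ s, 0 ≤ f s := fun s =>
    (mul_nonneg hc₀.le (mmin_nonneg _ _ _ (abs_nonneg s))).trans (hlow s)
  obtain ⟨δ, hδ, hδ1, hδε⟩ : ∃ δ : ℝ, 0 < δ ∧ δ ≤ 1 ∧ δ * (K * 2 ^ q) ≤ ε * c₀ := by
    have h2 : 0 < K * (2:ℝ) ^ q + 1 := by positivity
    refine ⟨min 1 (ε * c₀ / (K * 2 ^ q + 1)), by positivity, min_le_left _ _, ?_⟩
    calc _ ≤ (ε * c₀ / (K * 2 ^ q + 1)) * (K * 2 ^ q + 1) := by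
            gcongr
            · exact min_le_right _ _
            · linarith
      _ = _ := by field_simp
  have hk : 1 ≤ 1 + 1 / δ := by
    have : 0 < 1 / δ := by positivity
    linarith
  have hkp : 0 ≤ (1 + 1 / δ) ^ q := rpow_nonneg (by linarith) _
  refine ⟨K * (1 + 1 / δ) ^ q / c₀, by positivity, fun a b => ?_⟩
  rcases eq_or_ne a 0 with rfl | ha
  · have := hfn b
    have := hfn 0
    simp only [zero_add, sub_self, abs_zero]
    positivity
  have ha' := abs_pos.2 ha
  have hm := mvt_bound f p q K hp hq hK hf hd a b
  have hg : ∀ k s : ℝ, 1 ≤ k → 0 < s → |a| + |b| ≤ k * s →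
      s * mmin (p - 1) (q - 1) (|a| + |b|) ≤ k ^ q * mmin p q s := by
    intro k s hk hs h
    have hks : 0 < k * s := by positivity
    calc s * mmin (p - 1) (q - 1) (|a| + |b|) ≤ (k * s) * mmin (p - 1) (q - 1) (k * s) := by
          apply mul_le_mul
          · nlinarith
          · exact mmin_mono _ _ _ _ (by linarith) (by linarith) (by positivity) h
          · exact mmin_nonneg _ _ _ (by positivity)
          · exact hks.le
      _ = mmin p q (k * s) := mul_mmin _ _ _ hks
      _ ≤ _ := mmin_scale _ _ _ _ hpq hk hs.le
  rcases le_total (δ * |b|) |a| with h | h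
  · have h1 := hg (1 + 1 / δ) |a| hk ha' (by
      have : |b| ≤ 1 / δ * |a| := by
        rw [one_div, ← div_eq_inv_mul, le_div_iff₀ hδ]; linarith
      linarith)
    have h2 : K * (1 + 1 / δ) ^ q / c₀ * (c₀ * mmin p q |a|) ≤
        K * (1 + 1 / δ) ^ q / c₀ * f a :=
      mul_le_mul_of_nonneg_left (hlow a) (by positivity)
    have h3 : K * (1 + 1 / δ) ^ q / c₀ * (c₀ * mmin p q |a|) =
      K * ((1 + 1 / δ) ^ q * mmin p q |a|) := by field_simp
    have h4 := mul_le_mul_of_nonneg_left h1 hK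
    have := mul_nonneg hε.le (hfn b)
    nlinarith
  · have hb : 0 < |b| := by
      by_contra hb
      have : |b| = 0 := le_antisymm (not_lt.1 hb) (abs_nonneg _)
      rw [this] at h; linarith
    have h1 := hg 2 |b| (by norm_num) hb (by nlinarith)
    have hG : 0 ≤ mmin (p - 1) (q - 1) (|a| + |b|) := mmin_nonneg _ _ _ (by positivity)
    have hM : 0 ≤ mmin p q |b| := mmin_nonneg _ _ _ (by positivity)
    calc |f (a + b) - f b| ≤ K * mmin (p - 1) (q - 1) (|a| + |b|) * |a| := hm
      _ ≤ K * mmin (p - 1) (q - 1) (|a| + |b|) * (δ * |b|) := by gcongr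
      _ = K * δ * (|b| * mmin (p - 1) (q - 1) (|a| + |b|)) := by ring
      _ ≤ K * δ * (2 ^ q * mmin p q |b|) := by gcongr
      _ = δ * (K * 2 ^ q) * mmin p q |b| := by ring
      _ ≤ ε * c₀ * mmin p q |b| := by gcongr
      _ = ε * (c₀ * mmin p q |b|) := by ring
      _ ≤ ε * f b := by gcongr; exact hlow b
      _ ≤ _ := by
        have : 0 ≤ K * (1 + 1 / δ) ^ q / c₀ * f a := mul_nonneg (by positivity) (hfn a)
        linarith

/-- Abstract Brezis-Lieb along an a.e. convergent sequence. -/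
lemma brezis_lieb {X : Type*} [MeasurableSpace X] (ν : Measure X) (f : ℝ → ℝ)
    (hfc : Continuous f) (hf0 : f 0 = 0) (hfn : ∀ s, 0 ≤ f s)
    (hkey : ∀ ε, 0 < ε → ∃ D, 0 ≤ D ∧ ∀ a b, |f (a + b) - f b| ≤ ε * f b + D * f a)
    (u : X → ℝ) (hu : Measurable u) (ψ : ℕ → X → ℝ) (hψ : ∀ n, Measurable (ψ n))
    (hui : Integrable (fun x => f (u x)) ν) (hψi : ∀ n, Integrable (fun x => f (ψ n x)) ν)
    (B : ℝ) (hB : ∀ n, ∫ x, f (ψ n x) ∂ν ≤ B)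
    (hae : ∀ᵐ x ∂ν, Tendsto (fun n => ψ n x) atTop (nhds 0)) :
    Tendsto (fun n => (∫ x, f (u x + ψ n x) ∂ν) - ∫ x, f (ψ n x) ∂ν)
      atTop (nhds (∫ x, f (u x) ∂ν)) := by
  have hsum : ∀ n, Integrable (fun x => f (u x + ψ n x)) ν := by
    intro n
    obtain ⟨D, hD, h⟩ := hkey 1 one_pos
    refine Integrable.mono' (((hψi n).const_mul 2).add (hui.const_mul D))
      (hfc.measurable.comp (hu.add (hψ n))).aestronglyMeasurable (Eventually.of_forall fun x => ?_)
    have := le_abs_self (f (u x + ψ n x) - f (ψ n x))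
    have := h (u x) (ψ n x)
    simp only [Real.norm_eq_abs, abs_of_nonneg (hfn _), Pi.add_apply]
    linarith
  set d : ℕ → X → ℝ := fun n x => f (u x + ψ n x) - f (ψ n x) - f (u x) with hd
  have hdi : ∀ n, Integrable (d n) ν := fun n => ((hsum n).sub (hψi n)).sub hui
  have hB0 : 0 ≤ B := (integral_nonneg fun x => hfn _).trans (hB 0)
  suffices h : Tendsto (fun n => ∫ x, d n x ∂ν) atTop (nhds 0) by
    have h2 := h.add_const (∫ x, f (u x) ∂ν)
    rw [zero_add] at h2
    refine h2.congr fun n => ?_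
    have : ∫ x, d n x ∂ν = (∫ x, f (u x + ψ n x) ∂ν) - (∫ x, f (ψ n x) ∂ν)
        - ∫ x, f (u x) ∂ν := by
      simp only [hd]
      have hs : Integrable (fun x => f (u x + ψ n x) - f (ψ n x)) ν := (hsum n).sub (hψi n)
      rw [integral_sub hs hui, integral_sub (hsum n) (hψi n)]
    rw [this]; ring
  rw [Metric.tendsto_atTop]
  intro η hη
  obtain ⟨ε, hε, hεη⟩ : ∃ ε : ℝ, 0 < ε ∧ ε * B ≤ η / 2 := by
    refine ⟨η / 2 / (B + 1), by positivity, ?_⟩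
    calc _ ≤ η / 2 / (B + 1) * (B + 1) := by gcongr; linarith
      _ = _ := by field_simp
  obtain ⟨D, hD, hk⟩ := hkey ε hε
  set w : ℕ → X → ℝ := fun n x => max (|d n x| - ε * f (ψ n x)) 0 with hw
  have hwi : ∀ n, Integrable (w n) ν := fun n =>
    ((hdi n).abs.sub ((hψi n).const_mul ε)).pos_part
  have hwt : Tendsto (fun n => ∫ x, w n x ∂ν) atTop (nhds 0) := by
    have := tendsto_integral_of_dominated_convergence (μ := ν) (F := w) (f := fun _ => (0:ℝ))
      (fun x => (D + 1) * f (u x)) (fun n => (hwi n).aestronglyMeasurable)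
      (hui.const_mul _) ?_ ?_
    · simpa using this
    · intro n
      refine Eventually.of_forall fun x => ?_
      have h1 := hk (u x) (ψ n x)
      have h2 := hfn (u x)
      have h3 : |d n x| ≤ |f (u x + ψ n x) - f (ψ n x)| + |f (u x)| := abs_sub _ _
      rw [abs_of_nonneg h2] at h3
      rw [Real.norm_eq_abs, abs_of_nonneg (le_max_right _ _)]
      refine max_le ?_ (by positivity)
      linarith
    · filter_upwards [hae] with x hx
      have h1 : Tendsto (fun n => f (ψ n x)) atTop (nhds 0) := by
        have := (hfc.tendsto 0).comp hx
        rwa [hf0] at this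
      have h2 : Tendsto (fun n => f (u x + ψ n x)) atTop (nhds (f (u x))) := by
        have := (hfc.tendsto (u x + 0)).comp (hx.const_add (u x))
        rwa [add_zero] at this
      have h3 : Tendsto (fun n => d n x) atTop (nhds 0) := by
        have := (h2.sub h1).sub_const (f (u x))
        simpa using this
      have h4 := (h3.abs.sub (h1.const_mul ε)).max (tendsto_const_nhds (x := (0:ℝ)))
      simpa using h4
  obtain ⟨n₀, hn₀⟩ := (Metric.tendsto_atTop.1 hwt) (η / 2) (by positivity)
  refine ⟨n₀, fun n hn => ?_⟩
  have h1 := hn₀ n hn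
  rw [dist_zero_right, Real.norm_eq_abs] at h1 ⊢
  have h2 : |∫ x, d n x ∂ν| ≤ ∫ x, |d n x| ∂ν := abs_integral_le_integral_abs
  have h3 : ∫ x, |d n x| ∂ν ≤ ∫ x, (w n x + ε * f (ψ n x)) ∂ν := by
    refine integral_mono (hdi n).abs ((hwi n).add ((hψi n).const_mul ε)) fun x => ?_
    have := le_max_left (|d n x| - ε * f (ψ n x)) 0
    simp only [hw]
    linarith
  rw [integral_add (hwi n) ((hψi n).const_mul ε), integral_const_mul] at h3
  have h4 := mul_le_mul_of_nonneg_left (hB n) hε.le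
  have h5 := le_abs_self (∫ x, w n x ∂ν)
  linarith

lemma exists_ae_subseq (N : ℕ) (p r : ℝ) (hp : 0 < p) (hpr : p ≤ r)
    (ψ : ℕ → EuclideanSpace ℝ (Fin N) → ℝ) (hψ_meas : ∀ n, Measurable (ψ n))
    (hψ_int : ∀ n, Integrable (fun x => |ψ n x| ^ r))
    (hψ_loc : ∀ R : ℝ, 0 < R →
      Tendsto (fun n => ∫ x in Metric.closedBall (0 : EuclideanSpace ℝ (Fin N)) R,
        |ψ n x| ^ p) atTop (nhds 0)) :
    ∃ ns : ℕ → ℕ, ∀ᵐ x, Tendsto (fun k => ψ (ns k) x) atTop (nhds 0) := by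
  have hli : ∀ n R, IntegrableOn (fun x => |ψ n x| ^ p)
      (Metric.closedBall (0 : EuclideanSpace ℝ (Fin N)) R) := by
    intro n R
    have h1 : IntegrableOn (fun x => 1 + |ψ n x| ^ r)
      (Metric.closedBall (0 : EuclideanSpace ℝ (Fin N)) R) :=
      (integrableOn_const measure_closedBall_lt_top.ne).add (hψ_int n).integrableOn
    refine Integrable.mono' h1 ((hψ_meas n).abs.pow_const p).aestronglyMeasurable
      (Eventually.of_forall fun x => ?_)
    rw [Real.norm_eq_abs, abs_of_nonneg (rpow_nonneg (abs_nonneg _) _)]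
    have h0 := rpow_nonneg (abs_nonneg (ψ n x)) r
    rcases le_total |ψ n x| 1 with h | h
    · have := rpow_le_one (abs_nonneg (ψ n x)) h hp.le
      linarith
    · have := rpow_le_rpow_of_exponent_le h hpr
      linarith
  have hex : ∀ k : ℕ, ∃ n, ∫ x in Metric.closedBall (0 : EuclideanSpace ℝ (Fin N)) (k + 1),
      |ψ n x| ^ p < 1 / ((k : ℝ) + 1) := by
    intro k
    exact ((hψ_loc (k + 1) (by positivity)).eventually_lt_const (by positivity)).exists
  choose m hm using hex
  set h : ℕ → EuclideanSpace ℝ (Fin N) → ℝ := fun k =>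
    (Metric.closedBall (0 : EuclideanSpace ℝ (Fin N)) (k + 1)).indicator
      (fun x => |ψ (m k) x| ^ p) with hh
  have hhi : ∀ k, Integrable (h k) := fun k =>
    (integrable_indicator_iff measurableSet_closedBall).2 (hli _ _)
  have hhn : ∀ k x, 0 ≤ h k x := fun k x =>
    Set.indicator_nonneg (fun x _ => rpow_nonneg (abs_nonneg _) _) x
  have hlim : Tendsto (fun k => eLpNorm (h k - 0) 1 volume) atTop (nhds 0) := by
    have h1 : ∀ k, eLpNorm (h k - 0) 1 volume = ENNReal.ofReal (∫ x, h k x) := by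
      intro k
      rw [sub_zero, eLpNorm_one_eq_lintegral_enorm,
        ofReal_integral_eq_lintegral_ofReal (hhi k) (Eventually.of_forall (hhn k))]
      refine lintegral_congr fun x => ?_
      rw [← ofReal_norm, Real.norm_of_nonneg (hhn k x)]
    simp_rw [h1]
    rw [← ENNReal.ofReal_zero]
    refine ENNReal.tendsto_ofReal ?_
    refine squeeze_zero (fun k => integral_nonneg (hhn k)) (fun k => ?_)
      tendsto_one_div_add_atTop_nhds_zero_nat
    simp only [hh]
    rw [integral_indicator measurableSet_closedBall]
    exact (hm k).le
  have hmeas := tendstoInMeasure_of_tendsto_eLpNorm (p := 1) one_ne_zero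
    (fun k => (hhi k).aestronglyMeasurable) aestronglyMeasurable_zero hlim
  obtain ⟨ks, hks, hae⟩ := hmeas.exists_seq_tendsto_ae
  refine ⟨fun j => m (ks j), ?_⟩
  filter_upwards [hae] with x hx
  have h1 : Tendsto (fun j => |ψ (m (ks j)) x| ^ p) atTop (nhds 0) := by
    refine hx.congr' ?_
    obtain ⟨n₀, hn₀⟩ := exists_nat_gt ‖x‖
    filter_upwards [hks.tendsto_atTop.eventually_ge_atTop n₀] with j hj
    simp only [hh]
    rw [Set.indicator_of_mem]
    rw [mem_closedBall_zero_iff]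
    have : (n₀ : ℝ) ≤ ks j := by exact_mod_cast hj
    linarith
  have h2 := h1.rpow_const (p := 1 / p) (Or.inr (by positivity))
  rw [zero_rpow (by positivity)] at h2
  rw [tendsto_zero_iff_abs_tendsto_zero]
  refine h2.congr fun j => ?_
  rw [← rpow_mul (abs_nonneg _), mul_one_div_cancel hp.ne', rpow_one]
  rfl

theorem stmt15 (N : ℕ) (hN : 3 ≤ N)
    (f : ℝ → ℝ) (p q c₀ c₂ μ₁ μ₂ : ℝ)
    (hf_even : ∀ s : ℝ, f (-s) = f s) (hf_C1 : ContDiff ℝ 1 f)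
    (hf0 : f 0 = 0) (hf'0 : deriv f 0 = 0)
    (hf_diff2 : ∀ s : ℝ, s ≠ 0 → DifferentiableAt ℝ (deriv f) s)
    (hf_diff3 : ∀ s : ℝ, s ≠ 0 → DifferentiableAt ℝ (deriv (deriv f)) s)
    (hc₀ : 0 < c₀) (hc₂ : 0 < c₂) (hp : 2 < p)
    (hp2 : p < 2 * N / (N - 2 : ℝ)) (hq : 2 * N / (N - 2 : ℝ) < q)
    (hμ₁ : 2 < μ₁) (hμ₂ : 1 < μ₂)
    (hf_low1 : ∀ s : ℝ, 1 ≤ |s| → c₀ * |s| ^ p ≤ f s)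
    (hf_low2 : ∀ s : ℝ, |s| ≤ 1 → c₀ * |s| ^ q ≤ f s)
    (hf2_1 : ∀ s : ℝ, 1 ≤ |s| → |deriv (deriv f) s| ≤ c₂ * |s| ^ (p - 2))
    (hf2_2 : ∀ s : ℝ, 0 < |s| → |s| ≤ 1 → |deriv (deriv f) s| ≤ c₂ * |s| ^ (q - 2))
    (hfμ1 : ∀ s : ℝ, s ≠ 0 → 0 < μ₁ * f s ∧ μ₁ * f s ≤ s * deriv f s)
    (hfμ2 : ∀ s : ℝ, s ≠ 0 → μ₂ * (s * deriv f s) < s ^ 2 * deriv (deriv f) s)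
    (hfμ3 : ∀ s : ℝ, s ≠ 0 → 0 < s ^ 3 * deriv (deriv (deriv f)) s)
    (u₀ : EuclideanSpace ℝ (Fin N) → ℝ) (hu₀_meas : Measurable u₀)
    (hu₀_p : IntegrableOn (fun x => |u₀ x| ^ p) {x | 1 ≤ |u₀ x|})
    (hu₀_q : IntegrableOn (fun x => |u₀ x| ^ q) {x | |u₀ x| < 1})
    (ψ : ℕ → EuclideanSpace ℝ (Fin N) → ℝ) (hψ_meas : ∀ n, Measurable (ψ n))
    (hψ_int : ∀ n, Integrable (fun x => |ψ n x| ^ (2 * N / (N - 2 : ℝ))))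
    (C : ℝ) (hψ_bdd : ∀ n, (∫ x, |ψ n x| ^ (2 * N / (N - 2 : ℝ))) ≤ C)
    (hψ_loc : ∀ R : ℝ, 0 < R →
      Tendsto (fun n => ∫ x in Metric.closedBall (0 : EuclideanSpace ℝ (Fin N)) R,
        |ψ n x| ^ p) atTop (nhds 0)) :
    Tendsto (fun n => (∫ x, f (u₀ x + ψ n x)) - ∫ x, f (ψ n x))
      atTop (nhds (∫ x, f (u₀ x))) := by
  set r : ℝ := 2 * N / (N - 2 : ℝ) with hr
  have hpq : p ≤ q := by linarith
  have hf : Differentiable ℝ f := hf_C1.differentiable one_ne_zero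
  have hfc : Continuous f := hf.continuous
  have hd : ∀ s, |deriv f s| ≤ c₂ * mmin (p - 1) (q - 1) |s| := by
    intro s
    rcases eq_or_ne s 0 with rfl | hs
    · rw [hf'0, abs_zero]
      exact mul_nonneg hc₂.le (mmin_nonneg _ _ _ le_rfl)
    have hs' := abs_pos.2 hs
    have h2 : |deriv (deriv f) s| ≤ c₂ * mmin (p - 1 - 1) (q - 1 - 1) |s| := by
      rcases le_total 1 |s| with h | h
      · rw [mmin_one_le _ _ _ (by linarith) h]
        convert hf2_1 s h using 3; ring
      · rw [mmin_le_one _ _ _ (by linarith) hs' h]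
        convert hf2_2 s hs' h using 3; ring
    have h3 : 0 < s * deriv f s := (hfμ1 s hs).1.trans_le (hfμ1 s hs).2
    have h4 := hfμ2 s hs
    have h5 : |s| * |deriv f s| ≤ |s| * (|s| * |deriv (deriv f) s|) := by
      have e1 : |s| * |deriv f s| = s * deriv f s := by rw [← abs_mul, abs_of_pos h3]
      have e2 : |s| * (|s| * |deriv (deriv f) s|) = s ^ 2 * |deriv (deriv f) s| := by
        rw [← sq_abs s]; ring
      rw [e1, e2]
      have := mul_le_mul_of_nonneg_left (le_abs_self (deriv (deriv f) s)) (sq_nonneg s)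
      nlinarith
    have h6 := le_of_mul_le_mul_left h5 hs'
    rw [← mul_mmin (p - 1) (q - 1) |s| hs']
    have := mul_le_mul_of_nonneg_left h2 hs'.le
    linarith
  have hlow : ∀ s, c₀ * mmin p q |s| ≤ f s := by
    intro s
    rcases le_total 1 |s| with h | h
    · rw [mmin_one_le _ _ _ hpq h]; exact hf_low1 s h
    · refine le_trans ?_ (hf_low2 s h)
      exact mul_le_mul_of_nonneg_left (min_le_right _ _) hc₀.le
  have hfn : ∀ s, 0 ≤ f s := fun s =>
    (mul_nonneg hc₀.le (mmin_nonneg _ _ _ (abs_nonneg s))).trans (hlow s)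
  have hup : ∀ s, f s ≤ c₂ * mmin p q |s| := fun s =>
    (le_abs_self _).trans
      (upper_bound f p q c₂ (by linarith) (by linarith) hc₂.le hf hf0 hd s)
  have hupr : ∀ s, f s ≤ c₂ * |s| ^ r := by
    intro s
    rcases eq_or_ne s 0 with rfl | hs
    · rw [hf0]; exact mul_nonneg hc₂.le (rpow_nonneg (abs_nonneg _) _)
    refine (hup s).trans (mul_le_mul_of_nonneg_left ?_ hc₂.le)
    rcases le_total 1 |s| with h | h
    · exact (min_le_left _ _).trans (rpow_le_rpow_of_exponent_le h hp2.le)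
    · exact (min_le_right _ _).trans
        (rpow_le_rpow_of_exponent_ge (abs_pos.2 hs) h hq.le)
  have hui : Integrable (fun x => f (u₀ x)) := by
    have hm1 : AEStronglyMeasurable (fun x => f (u₀ x)) volume :=
      (hfc.measurable.comp hu₀_meas).aestronglyMeasurable
    rw [← integrableOn_univ]
    have : (Set.univ : Set (EuclideanSpace ℝ (Fin N))) =
        {x | 1 ≤ |u₀ x|} ∪ {x | |u₀ x| < 1} := by
      ext x; simp [le_or_gt]
    rw [this]
    refine IntegrableOn.union ?_ ?_
    · refine Integrable.mono' (hu₀_p.const_mul c₂) hm1.restrict (Eventually.of_forall fun x => ?_)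
      rw [Real.norm_of_nonneg (hfn _)]
      exact (hup _).trans (mul_le_mul_of_nonneg_left (min_le_left _ _) hc₂.le)
    · refine Integrable.mono' (hu₀_q.const_mul c₂) hm1.restrict (Eventually.of_forall fun x => ?_)
      rw [Real.norm_of_nonneg (hfn _)]
      exact (hup _).trans (mul_le_mul_of_nonneg_left (min_le_right _ _) hc₂.le)
  have hψi : ∀ n, Integrable (fun x => f (ψ n x)) := by
    intro n
    refine Integrable.mono' ((hψ_int n).const_mul c₂)
      (hfc.measurable.comp (hψ_meas n)).aestronglyMeasurable (Eventually.of_forall fun x => ?_)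
    rw [Real.norm_of_nonneg (hfn _)]
    exact hupr _
  have hB : ∀ n, ∫ x, f (ψ n x) ≤ c₂ * C := by
    intro n
    have h1 : ∫ x, f (ψ n x) ≤ ∫ x, c₂ * |ψ n x| ^ r :=
      integral_mono (hψi n) ((hψ_int n).const_mul c₂) fun x => hupr _
    rw [integral_const_mul] at h1
    exact h1.trans (mul_le_mul_of_nonneg_left (hψ_bdd n) hc₂.le)
  have hkey := key_ineq f p q c₂ c₀ (by linarith) hpq hc₂.le hc₀ hf hd hlow
  refine tendsto_of_subseq_tendsto fun ns hns => ?_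
  obtain ⟨ms, hms⟩ := exists_ae_subseq N p r (by linarith) hp2.le (fun k => ψ (ns k))
    (fun k => hψ_meas _) (fun k => hψ_int _) (fun R hR => (hψ_loc R hR).comp hns)
  exact ⟨ms, brezis_lieb volume f hfc hf0 hfn hkey u₀ hu₀_meas (fun k => ψ (ns (ms k)))
    (fun k => hψ_meas _) hui (fun k => hψi _) (c₂ * C) (fun k => hB _) hms⟩
end

section
/- Let (ψ_n) be a sequence of measurable functions on ℝ^N with sup_n ∫_{ℝ^N}|ψ_n|^{2*} dx < ∞ and such that for every R > 0 and every r ∈ [1, 2*), ∫_{B_R}|ψ_n|^r dx → 0 as n → ∞, where B_R is the closed ball of radius R centered at the origin. Then ∫_{ℝ^N} V(x)·ψ_n(x)² dx → 0 as n → ∞. (First conclusion of Lemma 3.3.) -/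
open Real MeasureTheory Filter

lemma aux_memLp {α : Type*} [MeasurableSpace α] {μ : Measure α} {f : α → ℝ} (hf : Measurable f)
    (h0 : ∀ x, 0 ≤ f x) {p : ℝ} (hp : 0 < p) (hi : Integrable (fun x => f x ^ p) μ) :
    MemLp f (ENNReal.ofReal p) μ := by
  rw [← integrable_norm_rpow_iff hf.aestronglyMeasurable (by simpa using hp) (by simp)]
  rw [ENNReal.toReal_ofReal hp.le]
  simpa [abs_of_nonneg (h0 _)] using hi

/-- First conclusion of Lemma 3.3: if `ψ_n` is bounded in `L^{2*}` and `ψ_n → 0` in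
`L^r(B_R)` for every `R > 0` and `r ∈ [1, 2*)`, then `∫ V ψ_n² → 0`, where
`V ∈ L^{N/2} ∩ L^t` for some `t > N/2`. -/
theorem stmt16 (N : ℕ) (hN : 3 ≤ N)
    (V : EuclideanSpace ℝ (Fin N) → ℝ) (hV_meas : Measurable V)
    (hV_N2 : Integrable (fun x => |V x| ^ ((N : ℝ) / 2)))
    (t : ℝ) (ht : (N : ℝ) / 2 < t)
    (hV_t : Integrable (fun x => |V x| ^ t))
    (ψ : ℕ → EuclideanSpace ℝ (Fin N) → ℝ) (hψ_meas : ∀ n, Measurable (ψ n))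
    (hψ_int : ∀ n, Integrable (fun x => |ψ n x| ^ (2 * N / (N - 2 : ℝ))))
    (C : ℝ) (hψ_bdd : ∀ n, (∫ x, |ψ n x| ^ (2 * N / (N - 2 : ℝ))) ≤ C)
    (hψ_loc : ∀ R : ℝ, 0 < R → ∀ r : ℝ, 1 ≤ r → r < 2 * N / (N - 2 : ℝ) →
      Tendsto (fun n => ∫ x in Metric.closedBall (0 : EuclideanSpace ℝ (Fin N)) R,
        |ψ n x| ^ r) atTop (nhds 0)) :
    Tendsto (fun n => ∫ x, V x * (ψ n x) ^ 2) atTop (nhds 0) := by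
  have hN' : (3 : ℝ) ≤ N := by exact_mod_cast hN
  have hN2 : (0 : ℝ) < N - 2 := by linarith
  obtain ⟨p, hp⟩ : ∃ p : ℝ, p = (N : ℝ) / 2 := ⟨_, rfl⟩
  obtain ⟨q, hq⟩ : ∃ q : ℝ, q = (N : ℝ) / (N - 2) := ⟨_, rfl⟩
  obtain ⟨s, hs⟩ : ∃ s : ℝ, s = 2 * N / (N - 2 : ℝ) := ⟨_, rfl⟩
  have hsq : s = 2 * q := by rw [hs, hq]; ring
  have hp0 : 0 < p := by rw [hp]; linarith
  have hq1 : 1 < q := by rw [hq, lt_div_iff₀ hN2]; linarith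
  have hq0 : 0 < q := by linarith
  have hpq : p.HolderConjugate q := by
    rw [Real.holderConjugate_iff]
    refine ⟨by rw [hp]; linarith, ?_⟩
    rw [hp, hq]; field_simp; ring
  rw [← hp] at hV_N2
  rw [← hs] at hψ_int hψ_bdd hψ_loc
  have hC : 0 ≤ C := (integral_nonneg fun x => by positivity).trans (hψ_bdd 0)
  have hgq : ∀ n x, (ψ n x ^ 2) ^ q = |ψ n x| ^ s := by
    intro n x
    rw [hsq, Real.rpow_mul (abs_nonneg _)]
    norm_num
  have hg : ∀ n, MemLp (fun x => ψ n x ^ 2) (ENNReal.ofReal q) := fun n =>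
    aux_memLp ((hψ_meas n).pow_const 2) (fun x => sq_nonneg _) hq0
      (by simpa only [hgq] using hψ_int n)
  have hH : (ENNReal.ofReal p).HolderConjugate (ENNReal.ofReal q) := hpq.ennrealOfReal
  -- the truncated tail
  let A : ℕ → EuclideanSpace ℝ (Fin N) → ℝ := fun k =>
    ({x | ‖x‖ ≤ k + 1} ∩ {x | |V x| ≤ k + 1})ᶜ.indicator (fun x => |V x|)
  have hAm : ∀ k, Measurable (A k) := fun k =>
    hV_meas.abs.indicator ((measurableSet_le measurable_norm measurable_const).inter
      (measurableSet_le hV_meas.abs measurable_const)).compl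
  have hA0 : ∀ k x, 0 ≤ A k x := fun k x => Set.indicator_nonneg (fun _ _ => abs_nonneg _) _
  have hAV : ∀ k x, A k x ≤ |V x| := fun k x =>
    Set.indicator_le_self' (fun _ _ => abs_nonneg _) _
  have hAb : ∀ k x, ‖A k x ^ p‖ ≤ |V x| ^ p := fun k x => by
    rw [Real.norm_of_nonneg (Real.rpow_nonneg (hA0 k x) _)]
    exact Real.rpow_le_rpow (hA0 k x) (hAV k x) hp0.le
  have hAi : ∀ k, Integrable (fun x => A k x ^ p) := fun k =>
    hV_N2.mono' ((hAm k).pow_const p).aestronglyMeasurable (Eventually.of_forall (hAb k))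
  have hAlim : Tendsto (fun k => ∫ x, A k x ^ p) atTop (nhds 0) := by
    have := tendsto_integral_of_dominated_convergence (μ := volume)
      (F := fun k x => A k x ^ p) (f := fun _ => (0 : ℝ)) (fun x => |V x| ^ p)
      (fun k => (hAi k).aestronglyMeasurable) hV_N2 (fun k => Eventually.of_forall (hAb k))
      (Eventually.of_forall fun x => by
        refine tendsto_const_nhds.congr' ?_
        obtain ⟨k0, hk0⟩ := exists_nat_ge (max ‖x‖ |V x|)
        filter_upwards [eventually_ge_atTop k0] with k hk
        have hk' : (k0 : ℝ) ≤ k := by exact_mod_cast hk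
        have h1 : ‖x‖ ≤ k + 1 := by linarith [le_max_left ‖x‖ |V x|]
        have h2 : |V x| ≤ k + 1 := by linarith [le_max_right ‖x‖ |V x|]
        have : A k x = 0 := by simp [A, h1, h2]
        rw [this, Real.zero_rpow hp0.ne'])
    simpa using this
  have hlim2 : Tendsto (fun k => (∫ x, A k x ^ p) ^ (1 / p) * C ^ (1 / q)) atTop (nhds 0) := by
    have := (hAlim.rpow_const (p := 1 / p) (Or.inr (by positivity))).mul_const (C ^ (1 / q))
    rwa [Real.zero_rpow (by positivity), zero_mul] at this
  have hAg : ∀ k n, Integrable (fun x => A k x * ψ n x ^ 2) := fun k n =>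
    (aux_memLp (hAm k) (hA0 k) hp0 (hAi k)).integrable_mul (hg n)
  have hHol : ∀ k n, ∫ x, A k x * ψ n x ^ 2 ≤ (∫ x, A k x ^ p) ^ (1 / p) * C ^ (1 / q) := by
    intro k n
    refine (integral_mul_le_Lp_mul_Lq_of_nonneg hpq (Eventually.of_forall (hA0 k))
      (Eventually.of_forall fun x => sq_nonneg _)
      (aux_memLp (hAm k) (hA0 k) hp0 (hAi k)) (hg n)).trans ?_
    simp only [hgq]
    have : 0 ≤ ∫ x, A k x ^ p := integral_nonneg fun x => Real.rpow_nonneg (hA0 k x) p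
    gcongr
    · exact hψ_bdd n
  have hloc : ∀ (R : ℝ) n, IntegrableOn (fun x => ψ n x ^ 2) (Metric.closedBall 0 R) := by
    intro R n
    haveI : IsFiniteMeasure (volume.restrict
      (Metric.closedBall (0 : EuclideanSpace ℝ (Fin N)) R)) :=
      ⟨by simpa using measure_closedBall_lt_top⟩
    exact ((hg n).restrict _).integrable (by simpa using hq1.le)
  rw [Metric.tendsto_atTop]
  intro ε hε
  obtain ⟨k, hk⟩ := ((tendsto_order.1 hlim2).2 (ε / 2) (by positivity)).exists
  have h2 := (hψ_loc (k + 1) (by positivity) 2 (by norm_num) (by rw [hsq]; linarith)).const_mul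
    ((k : ℝ) + 1)
  rw [mul_zero] at h2
  obtain ⟨n0, hn0⟩ := eventually_atTop.1 ((tendsto_order.1 h2).2 (ε / 2) (by positivity))
  refine ⟨n0, fun n hn => ?_⟩
  have h3 := hn0 n hn
  simp only [Real.rpow_two, sq_abs] at h3
  rw [dist_zero_right]
  have hI : Integrable (fun x => ((k : ℝ) + 1) *
      (Metric.closedBall (0 : EuclideanSpace ℝ (Fin N)) (k + 1)).indicator
        (fun x => ψ n x ^ 2) x) :=
    ((integrable_indicator_iff Metric.isClosed_closedBall.measurableSet).2 (hloc _ n)).const_mul _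
  have := norm_integral_le_of_norm_le (f := fun x => V x * ψ n x ^ 2) (hI.add (hAg k n))
    (Eventually.of_forall fun x => by
      simp only [Pi.add_apply, norm_mul, Real.norm_eq_abs, abs_of_nonneg (sq_nonneg (ψ n x))]
      by_cases hx : ‖x‖ ≤ k + 1 ∧ |V x| ≤ k + 1
      · have : x ∈ Metric.closedBall (0 : EuclideanSpace ℝ (Fin N)) (k + 1) := by
          simpa using hx.1
        rw [Set.indicator_of_mem this]
        have := mul_le_mul_of_nonneg_right hx.2 (sq_nonneg (ψ n x))
        have := mul_nonneg (hA0 k x) (sq_nonneg (ψ n x))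
        linarith
      · have h : A k x = |V x| := Set.indicator_of_mem (by simpa using hx) _
        rw [h]
        have : 0 ≤ (Metric.closedBall (0 : EuclideanSpace ℝ (Fin N)) (k + 1)).indicator
          (fun x => ψ n x ^ 2) x := Set.indicator_nonneg (fun _ _ => sq_nonneg _) _
        have : 0 ≤ ((k : ℝ) + 1) * (Metric.closedBall (0 : EuclideanSpace ℝ (Fin N))
          (k + 1)).indicator (fun x => ψ n x ^ 2) x := by positivity
        linarith)
  simp only [Pi.add_apply] at this
  rw [integral_add hI (hAg k n), integral_const_mul,
    integral_indicator Metric.isClosed_closedBall.measurableSet] at this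
  linarith [hHol k n]
end

section
/- Let (ψ_n) be a sequence of measurable functions on ℝ^N with sup_n ∫_{ℝ^N}|ψ_n|^{2*} dx < ∞ and such that for every R > 0 and every r ∈ [1, 2*), ∫_{B_R}|ψ_n|^r dx → 0 as n → ∞, where B_R is the closed ball of radius R centered at the origin. Then ∫_{ℝ^N} g(x)·ψ_n(x) dx → 0 as n → ∞. (Second conclusion of Lemma 3.3.) -/
open Real MeasureTheory Filter

/-- Second conclusion of Lemma 3.3: if `ψ_n` is bounded in `L^{2*}` and `ψ_n → 0` in
`L^r(B_R)` for every `R > 0` and `r ∈ [1, 2*)`, then `∫ g ψ_n → 0`, where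
`g ∈ L^{2N/(N+2)} ∩ L^s` for some `s > 2N/(N+2)`. -/
theorem stmt17 (N : ℕ) (hN : 3 ≤ N)
    (g : EuclideanSpace ℝ (Fin N) → ℝ) (hg_meas : Measurable g)
    (hg_base : Integrable (fun x => |g x| ^ (2 * N / (N + 2 : ℝ))))
    (s : ℝ) (hs : 2 * N / (N + 2 : ℝ) < s)
    (hg_s : Integrable (fun x => |g x| ^ s))
    (ψ : ℕ → EuclideanSpace ℝ (Fin N) → ℝ) (hψ_meas : ∀ n, Measurable (ψ n))
    (hψ_int : ∀ n, Integrable (fun x => |ψ n x| ^ (2 * N / (N - 2 : ℝ))))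
    (C : ℝ) (hψ_bdd : ∀ n, (∫ x, |ψ n x| ^ (2 * N / (N - 2 : ℝ))) ≤ C)
    (hψ_loc : ∀ R : ℝ, 0 < R → ∀ r : ℝ, 1 ≤ r → r < 2 * N / (N - 2 : ℝ) →
      Tendsto (fun n => ∫ x in Metric.closedBall (0 : EuclideanSpace ℝ (Fin N)) R,
        |ψ n x| ^ r) atTop (nhds 0)) :
    Tendsto (fun n => ∫ x, g x * ψ n x) atTop (nhds 0) := by
  have hN3 : (3:ℝ) ≤ N := by exact_mod_cast hN
  set p : ℝ := 2 * N / (N + 2 : ℝ) with hp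
  set q : ℝ := 2 * N / (N - 2 : ℝ) with hq
  have hp1 : 1 < p := by rw [hp, lt_div_iff₀ (by linarith)]; linarith
  have hq1 : 1 < q := by rw [hq, lt_div_iff₀ (by linarith)]; linarith
  have hpq : p.HolderConjugate q := by
    rw [Real.holderConjugate_iff]
    refine ⟨hp1, ?_⟩
    have h1 : (N:ℝ) - 2 ≠ 0 := by linarith
    have h2 : (N:ℝ) + 2 ≠ 0 := by linarith
    have h3 : (N:ℝ) ≠ 0 := by linarith
    rw [hp, hq, inv_div, inv_div]
    field_simp
    ring
  have hp0 : 0 < p := by linarith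
  have hq0 : 0 < q := by linarith
  have memlp : ∀ (f : EuclideanSpace ℝ (Fin N) → ℝ) (t : ℝ), 0 < t → Measurable f →
      Integrable (fun x => |f x| ^ t) → MemLp f (ENNReal.ofReal t) := by
    intro f t ht hf hi
    rw [← integrable_norm_rpow_iff hf.aestronglyMeasurable (by simpa using ht) (by simp),
      ENNReal.toReal_ofReal ht.le]
    simpa using hi
  let A : ℕ → Set (EuclideanSpace ℝ (Fin N)) := fun k =>
    (Metric.closedBall 0 ((k:ℝ) + 1) ∩ {x | |g x| ≤ (k:ℝ) + 1})ᶜ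
  have hA : ∀ k, MeasurableSet (A k) := fun k =>
    (measurableSet_closedBall.inter (measurableSet_le hg_meas.abs measurable_const)).compl
  let h : ℕ → EuclideanSpace ℝ (Fin N) → ℝ := fun k => (A k).indicator g
  have hh_meas : ∀ k, Measurable (h k) := fun k => hg_meas.indicator (hA k)
  have hh_le : ∀ k x, |h k x| ≤ |g x| := by
    intro k x
    by_cases hx : x ∈ A k
    · simp [h, hx]
    · simp [h, hx]
  have hh_dom : ∀ k x, ‖|h k x| ^ p‖ ≤ |g x| ^ p := by
    intro k x
    rw [Real.norm_of_nonneg (by positivity)]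
    exact Real.rpow_le_rpow (abs_nonneg _) (hh_le k x) hp0.le
  have hh_int : ∀ k, Integrable (fun x => |h k x| ^ p) := fun k =>
    hg_base.mono' ((hh_meas k).abs.pow_const p).aestronglyMeasurable
      (Eventually.of_forall (hh_dom k))
  have hh_lim : Tendsto (fun k => ∫ x, |h k x| ^ p) atTop (nhds 0) := by
    have := tendsto_integral_of_dominated_convergence (μ := volume)
      (F := fun k x => |h k x| ^ p) (f := fun _ => (0:ℝ)) (fun x => |g x| ^ p)
      (fun k => (hh_int k).aestronglyMeasurable) hg_base
      (fun k => Eventually.of_forall (hh_dom k)) ?_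
    · simpa using this
    · refine Eventually.of_forall fun x => ?_
      refine tendsto_const_nhds.congr' ?_
      obtain ⟨K, hK⟩ := exists_nat_ge (max ‖x‖ |g x|)
      filter_upwards [eventually_ge_atTop K] with k hk
      have hk' : (K:ℝ) ≤ k := by exact_mod_cast hk
      have h1 := (le_max_left _ _).trans hK
      have h2 := (le_max_right _ _).trans hK
      have hx : x ∉ A k := by
        simp only [A, Set.mem_compl_iff, not_not]
        refine ⟨?_, ?_⟩
        · rw [mem_closedBall_zero_iff]; linarith
        · show |g x| ≤ (k:ℝ) + 1
          linarith
      simp [h, hx, Real.zero_rpow hp0.ne']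
  have hC : 0 ≤ C := le_trans (integral_nonneg fun x => by positivity) (hψ_bdd 0)
  have hψ_mem : ∀ n, MemLp (ψ n) (ENNReal.ofReal q) := fun n =>
    memlp _ _ hq0 (hψ_meas n) (hψ_int n)
  have hh_mem : ∀ k, MemLp (h k) (ENNReal.ofReal p) := fun k =>
    memlp _ _ hp0 (hh_meas k) (hh_int k)
  have key : ∀ k n : ℕ, |∫ x, g x * ψ n x| ≤
      ((k:ℝ) + 1) * (∫ x in Metric.closedBall (0 : EuclideanSpace ℝ (Fin N)) ((k:ℝ) + 1),
        |ψ n x| ^ (1:ℝ)) + (∫ x, |h k x| ^ p) ^ (1 / p) * C ^ (1 / q) := by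
    intro k n
    have hold := integral_mul_norm_le_Lp_mul_Lq hpq (hh_mem k) (hψ_mem n)
    simp only [Real.norm_eq_abs] at hold
    have hold2 : (∫ x, |h k x| * |ψ n x|) ≤ (∫ x, |h k x| ^ p) ^ (1 / p) * C ^ (1 / q) := by
      refine hold.trans ?_
      gcongr
      exact hψ_bdd n
    have hi2 : Integrable (fun x => |h k x| * |ψ n x|) := by
      have : ENNReal.HolderConjugate (ENNReal.ofReal p) (ENNReal.ofReal q) := hpq.ennrealOfReal
      have := ((hh_mem k).integrable_mul (hψ_mem n)).norm
      simpa [abs_mul] using this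
    have hion : IntegrableOn (fun x => |ψ n x|)
        (Metric.closedBall (0 : EuclideanSpace ℝ (Fin N)) ((k:ℝ) + 1)) := by
      have : IsFiniteMeasure (volume.restrict
          (Metric.closedBall (0 : EuclideanSpace ℝ (Fin N)) ((k:ℝ) + 1))) :=
        ⟨by simpa using measure_closedBall_lt_top⟩
      have := ((hψ_mem n).restrict
        (Metric.closedBall (0 : EuclideanSpace ℝ (Fin N)) ((k:ℝ) + 1))).integrable
        (by simpa using hq1.le)
      exact this.norm
    have hi1 := (hion.integrable_indicator measurableSet_closedBall).const_mul ((k:ℝ) + 1)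
    simp only [Real.rpow_one]
    rw [← integral_indicator measurableSet_closedBall, ← integral_const_mul]
    refine le_trans ?_ (add_le_add le_rfl hold2)
    rw [← integral_add hi1 hi2, ← Real.norm_eq_abs]
    refine norm_integral_le_of_norm_le (hi1.add hi2) (Eventually.of_forall fun x => ?_)
    rw [norm_mul, Real.norm_eq_abs, Real.norm_eq_abs]
    by_cases hx : x ∈ A k
    · have : h k x = g x := by simp [h, hx]
      rw [this]
      have : 0 ≤ (Metric.closedBall (0 : EuclideanSpace ℝ (Fin N)) ((k:ℝ) + 1)).indicator
          (fun x => |ψ n x|) x := Set.indicator_nonneg (fun _ _ => abs_nonneg _) _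
      have : 0 ≤ ((k:ℝ) + 1) * (Metric.closedBall (0 : EuclideanSpace ℝ (Fin N))
        ((k:ℝ) + 1)).indicator (fun x => |ψ n x|) x := by positivity
      linarith
    · have h0 : h k x = 0 := by simp [h, hx]
      simp only [A, Set.mem_compl_iff, not_not] at hx
      have h2 : |g x| ≤ (k:ℝ) + 1 := hx.2
      rw [h0, Set.indicator_of_mem hx.1]
      simp only [abs_zero, zero_mul, add_zero]
      gcongr
  have hb_lim : Tendsto (fun k => (∫ x, |h k x| ^ p) ^ (1 / p) * C ^ (1 / q)) atTop (nhds 0) := by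
    have := (hh_lim.rpow_const (p := 1 / p) (Or.inr (by positivity))).mul_const (C ^ (1 / q))
    rwa [Real.zero_rpow (by positivity), zero_mul] at this
  rw [Metric.tendsto_atTop']
  intro ε hε
  obtain ⟨k, hk⟩ := (hb_lim.eventually (gt_mem_nhds (half_pos hε))).exists
  have hl := (hψ_loc ((k:ℝ) + 1) (by positivity) 1 le_rfl hq1).const_mul ((k:ℝ) + 1)
  rw [mul_zero] at hl
  obtain ⟨M, hM⟩ := eventually_atTop.1 (hl.eventually (gt_mem_nhds (half_pos hε)))
  refine ⟨M, fun n hn => ?_⟩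
  rw [Real.dist_eq, sub_zero]
  have := key k n
  have := hM n hn.le
  linarith
end

section
/- Let (u_n) be a sequence of compactly supported C¹ functions on ℝ^N such that each u_n lies on the Nehari set, i.e. ‖u_n‖_V² = ∫_{ℝ^N} f'(u_n)·u_n dx + ∫_{ℝ^N} g·u_n dx, and such that the energies E_g(u_n) = ½‖u_n‖_V² − ∫_{ℝ^N} f(u_n) dx − ∫_{ℝ^N} g·u_n dx are bounded above. Then sup_n ‖u_n‖_V < ∞. (Lemma 3.1: Nehari sequences with bounded energy are bounded in the ‖·‖_V norm.) -/
open Real MeasureTheory Filter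

theorem aux18 (N : ℕ) (hN : 3 ≤ N)
    (g : EuclideanSpace ℝ (Fin N) → ℝ) (hg_meas : Measurable g)
    (hg_int : Integrable (fun x => |g x| ^ (2 * N / (N + 2 : ℝ)))) :
    ∃ K : ℝ, 0 ≤ K ∧ ∀ w : EuclideanSpace ℝ (Fin N) → ℝ, ContDiff ℝ 1 w →
      HasCompactSupport w →
      |∫ x, g x * w x| ≤ K * Real.sqrt (∫ x, ‖fderiv ℝ w x‖ ^ 2) := by
  have hN3 : (3 : ℝ) ≤ N := by exact_mod_cast hN
  have hr0 : (0 : ℝ) < 2 * N / (N - 2 : ℝ) := div_pos (by linarith) (by linarith)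
  have hs0 : (0 : ℝ) < 2 * N / (N + 2 : ℝ) := div_pos (by linarith) (by linarith)
  set r : NNReal := ⟨2 * N / (N - 2 : ℝ), hr0.le⟩ with hr
  set s : NNReal := ⟨2 * N / (N + 2 : ℝ), hs0.le⟩ with hs
  have hrv : (r : ℝ) = 2 * N / (N - 2 : ℝ) := rfl
  have hsv : (s : ℝ) = 2 * N / (N + 2 : ℝ) := rfl
  have hr0' : r ≠ 0 := by
    intro h; rw [← NNReal.coe_inj, hrv] at h; simp only [NNReal.coe_zero] at h; linarith
  have hs0' : s ≠ 0 := by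
    intro h; rw [← NNReal.coe_inj, hsv] at h; simp only [NNReal.coe_zero] at h; linarith
  have hg : MemLp g s volume := by
    rw [← integrable_norm_rpow_iff hg_meas.aestronglyMeasurable (by simpa using hs0') (by simp)]
    simpa [hsv, Real.norm_eq_abs] using hg_int
  have hconj : (s : ℝ).HolderConjugate r := by
    rw [Real.holderConjugate_iff, hrv, hsv]
    have : (N : ℝ) - 2 ≠ 0 := by linarith
    constructor
    · rw [lt_div_iff₀ (by linarith)]; linarith
    · field_simp; ring
  set S := eLpNormLESNormFDerivOfEqInnerConst (volume : Measure (EuclideanSpace ℝ (Fin N))) 2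
  refine ⟨(eLpNorm g s volume).toReal * S, by positivity, fun w hw hcs => ?_⟩
  have hsob : eLpNorm w r volume ≤ S * eLpNorm (fderiv ℝ w) 2 volume := by
    have := eLpNorm_le_eLpNorm_fderiv_of_eq_inner (volume : Measure (EuclideanSpace ℝ (Fin N)))
      hw hcs (p := 2) (p' := r) (by norm_num) (by simp; omega) (by
        have : (N : ℝ) - 2 ≠ 0 := by linarith
        simp only [finrank_euclideanSpace, Fintype.card_fin, hrv]
        push_cast
        field_simp)
    simpa using this
  have hcd : Continuous (fderiv ℝ w) := hw.continuous_fderiv (by norm_num)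
  have hmem : MemLp (fderiv ℝ w) 2 volume :=
    hcd.memLp_of_hasCompactSupport (hcs.fderiv ℝ)
  have hgrad : eLpNorm (fderiv ℝ w) 2 volume
      = ENNReal.ofReal (Real.sqrt (∫ x, ‖fderiv ℝ w x‖ ^ 2)) := by
    rw [hmem.eLpNorm_eq_integral_rpow_norm (by norm_num) (by norm_num)]
    simp [Real.sqrt_eq_rpow]
  have hH : ‖∫ x, g x * w x‖ₑ ≤ eLpNorm g s volume * eLpNorm w r volume := by
    refine (enorm_integral_le_lintegral_enorm _).trans ?_
    rw [eLpNorm_eq_lintegral_rpow_enorm_toReal (by simpa using hs0') (by simp),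
      eLpNorm_eq_lintegral_rpow_enorm_toReal (by simpa using hr0') (by simp)]
    have := ENNReal.lintegral_mul_le_Lp_mul_Lq (volume : Measure (EuclideanSpace ℝ (Fin N)))
      hconj (f := fun x => ‖g x‖ₑ) (g := fun x => ‖w x‖ₑ) (by fun_prop)
      (hw.continuous.measurable.enorm.aemeasurable)
    simpa [enorm_mul] using this
  have hfin := hH.trans (mul_le_mul_right hsob _)
  rw [hgrad] at hfin
  have h2 := ENNReal.toReal_mono (by
    exact ENNReal.mul_ne_top hg.eLpNorm_ne_top
      (ENNReal.mul_ne_top ENNReal.coe_ne_top ENNReal.ofReal_ne_top)) hfin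
  rw [ENNReal.toReal_mul, ENNReal.toReal_mul, ENNReal.toReal_ofReal (Real.sqrt_nonneg _)] at h2
  rw [mul_assoc]
  simpa using h2

theorem stmt18 (N : ℕ) (hN : 3 ≤ N)
    (f : ℝ → ℝ) (p q c₀ c₂ μ₁ μ₂ : ℝ)
    (hf_even : ∀ s : ℝ, f (-s) = f s) (hf_C1 : ContDiff ℝ 1 f)
    (hf0 : f 0 = 0) (hf'0 : deriv f 0 = 0)
    (hf_diff2 : ∀ s : ℝ, s ≠ 0 → DifferentiableAt ℝ (deriv f) s)
    (hf_diff3 : ∀ s : ℝ, s ≠ 0 → DifferentiableAt ℝ (deriv (deriv f)) s)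
    (hc₀ : 0 < c₀) (hc₂ : 0 < c₂) (hp : 2 < p)
    (hp2 : p < 2 * N / (N - 2 : ℝ)) (hq : 2 * N / (N - 2 : ℝ) < q)
    (hμ₁ : 2 < μ₁) (hμ₂ : 1 < μ₂)
    (hf_low1 : ∀ s : ℝ, 1 ≤ |s| → c₀ * |s| ^ p ≤ f s)
    (hf_low2 : ∀ s : ℝ, |s| ≤ 1 → c₀ * |s| ^ q ≤ f s)
    (hf2_1 : ∀ s : ℝ, 1 ≤ |s| → |deriv (deriv f) s| ≤ c₂ * |s| ^ (p - 2))
    (hf2_2 : ∀ s : ℝ, 0 < |s| → |s| ≤ 1 → |deriv (deriv f) s| ≤ c₂ * |s| ^ (q - 2))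
    (hfμ1 : ∀ s : ℝ, s ≠ 0 → 0 < μ₁ * f s ∧ μ₁ * f s ≤ s * deriv f s)
    (hfμ2 : ∀ s : ℝ, s ≠ 0 → μ₂ * (s * deriv f s) < s ^ 2 * deriv (deriv f) s)
    (hfμ3 : ∀ s : ℝ, s ≠ 0 → 0 < s ^ 3 * deriv (deriv (deriv f)) s)
    (V : EuclideanSpace ℝ (Fin N) → ℝ) (hV_meas : Measurable V)
    (hV_loc : LocallyIntegrable V) (hV_nonpos : ∀ᵐ x, V x ≤ 0)
    (θ : ℝ) (hθ0 : 0 < θ) (hθ1 : θ ≤ 1)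
    (hcoerc : ∀ w : EuclideanSpace ℝ (Fin N) → ℝ, ContDiff ℝ 1 w →
      HasCompactSupport w →
      θ * (∫ x, ‖fderiv ℝ w x‖ ^ 2) ≤
        ∫ x, (‖fderiv ℝ w x‖ ^ 2 + V x * w x ^ 2))
    (g : EuclideanSpace ℝ (Fin N) → ℝ) (hg_meas : Measurable g)
    (hg_int : Integrable (fun x => |g x| ^ (2 * N / (N + 2 : ℝ))))
    (u : ℕ → EuclideanSpace ℝ (Fin N) → ℝ)
    (hu_C1 : ∀ n, ContDiff ℝ 1 (u n)) (hu_supp : ∀ n, HasCompactSupport (u n))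
    (hu_nehari : ∀ n, (∫ x, (‖fderiv ℝ (u n) x‖ ^ 2 + V x * u n x ^ 2)) =
      (∫ x, deriv f (u n x) * u n x) + ∫ x, g x * u n x)
    (C : ℝ)
    (hu_energy : ∀ n,
      (1 / 2) * (∫ x, (‖fderiv ℝ (u n) x‖ ^ 2 + V x * u n x ^ 2)) -
        (∫ x, f (u n x)) - (∫ x, g x * u n x) ≤ C) :
    ∃ M : ℝ, ∀ n, (∫ x, (‖fderiv ℝ (u n) x‖ ^ 2 + V x * u n x ^ 2)) ≤ M := by
  obtain ⟨K, hK, hKw⟩ := aux18 N hN g hg_meas hg_int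
  have hμ : 0 < μ₁ / 2 - 1 := by linarith
  set a := μ₁ / 2 - 1 with ha
  set B := (μ₁ - 1) * K with hB
  refine ⟨(2 * μ₁ * C + B ^ 2 / (a * θ)) / a, fun n => ?_⟩
  have hco := hcoerc (u n) (hu_C1 n) (hu_supp n)
  have hneh := hu_nehari n
  have hen := hu_energy n
  have hG := hKw (u n) (hu_C1 n) (hu_supp n)
  have hD0 : 0 ≤ ∫ x, ‖fderiv ℝ (u n) x‖ ^ 2 := integral_nonneg fun x => by positivity
  have huc : Continuous (u n) := (hu_C1 n).continuous
  have hdf : Continuous (deriv f) := hf_C1.continuous_deriv (by norm_num)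
  have hF : μ₁ * (∫ x, f (u n x)) ≤ ∫ x, deriv f (u n x) * u n x := by
    rw [← integral_const_mul]
    refine integral_mono ?_ ?_ fun x => ?_
    · refine Continuous.integrable_of_hasCompactSupport
        (continuous_const.mul (hf_C1.continuous.comp huc)) ?_
      exact (hu_supp n).comp_left (g := fun s => μ₁ * f s) (by simp [hf0])
    · refine Continuous.integrable_of_hasCompactSupport
        ((hdf.comp huc).mul huc) ?_
      exact (hu_supp n).comp_left (g := fun s => deriv f s * s) (by simp)
    · by_cases h : u n x = 0
      · simp [h, hf0]
      · have := (hfμ1 _ h).2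
        simp only
        linarith
  set A := ∫ x, (‖fderiv ℝ (u n) x‖ ^ 2 + V x * u n x ^ 2)
  set T := ∫ x, ‖fderiv ℝ (u n) x‖ ^ 2
  set G := ∫ x, g x * u n x
  set F := ∫ x, f (u n x)
  have hG' := le_of_abs_le hG
  have hsq := Real.sq_sqrt hD0
  set t := Real.sqrt T
  have h1 : a * A ≤ μ₁ * C + B * t := by
    have e1 : μ₁ * (1 / 2 * A - F - G) ≤ μ₁ * C := by gcongr
    have e2 : (μ₁ - 1) * G ≤ (μ₁ - 1) * (K * t) :=
      mul_le_mul_of_nonneg_left hG' (by linarith)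
    rw [ha, hB]; linarith
  have h2 : B * t ≤ a * (θ * T) / 2 + B ^ 2 / (a * θ) / 2 := by
    rw [← hsq]
    have hp' : 0 < a * θ := mul_pos hμ hθ0
    have e : B ^ 2 / (a * θ) = (B / (a * θ)) ^ 2 * (a * θ) := by field_simp
    have e' : B * t = (B / (a * θ)) * t * (a * θ) := by field_simp
    rw [e, e']
    nlinarith [mul_nonneg hp'.le (sq_nonneg (B / (a * θ) - t))]
  have h3 : a * (θ * T) ≤ a * A := mul_le_mul_of_nonneg_left hco hμ.le
  rw [le_div_iff₀ hμ]
  linarith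
end
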